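/- arXiv:1510.06303 — 10 statements merged into one kernel-verified Lean document; each statement's English description precedes it below -/
import Mathlib

section
/- Let I ⊆ (0,∞) be an open interval, let c : I → ℝ be smooth, let ν : I → ℝ be smooth with ν(u) < 0 and ν'(u) = ((c(u)−1)/u)·ν(u) for all u ∈ I, and let μ : I → ℝ be smooth with μ'(u) = −c(u)·ν(u) for all u ∈ I. Let f, g : ℝ → ℝ be smooth. Define φ : I × ℝ → ℝ by φ(u,s) = f(μ(u) + ν(u)s²) − 2ν(u)·s·∫₀ˢ f'(μ(u) + ν(u)z²) dz + g(u)·s. Then φ is smooth and satisfies (c(u)·u − (c(u)−1)·s²)·φ₂₂(u,s) = 2u·(φ₁(u,s) − s·φ₁₂(u,s)) for all (u,s) ∈ I × ℝ. -/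
open Real Set MeasureTheory intervalIntegral

/-- First partial derivative of `φ = φ(u,s)` with respect to `u`. -/
noncomputable def p1 (φ : ℝ → ℝ → ℝ) (u s : ℝ) : ℝ := deriv (fun t => φ t s) u

/-- First partial derivative of `φ = φ(u,s)` with respect to `s`. -/
noncomputable def p2 (φ : ℝ → ℝ → ℝ) (u s : ℝ) : ℝ := deriv (fun t => φ u t) s

/-- Second partial derivative `∂²φ/∂s²`. -/
noncomputable def p22 (φ : ℝ → ℝ → ℝ) (u s : ℝ) : ℝ := deriv (fun t => p2 φ u t) s

/-- Mixed partial derivative `∂²φ/∂u∂s`. -/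
noncomputable def p12 (φ : ℝ → ℝ → ℝ) (u s : ℝ) : ℝ := deriv (fun t => p2 φ t s) u

universe u

/-- An interval integral depending on a parameter is differentiable in the parameter when the
integrand is jointly `C¹`. -/
theorem hasFDerivAt_intervalIntegral_of_contDiff {H F : Type*}
    [NormedAddCommGroup H] [NormedSpace ℝ H] [NormedAddCommGroup F] [NormedSpace ℝ F]
    {h : H → ℝ → F} (hh : ContDiff ℝ 1 (Function.uncurry h)) (a b : ℝ) (x₀ : H) :
    HasFDerivAt (fun x => ∫ t in a..b, h x t)
      (∫ t in a..b,
        (fderiv ℝ (Function.uncurry h) (x₀, t)).comp (ContinuousLinearMap.inl ℝ H ℝ)) x₀ := by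
  have hF' : Continuous fun p : H × ℝ =>
      (fderiv ℝ (Function.uncurry h) p).comp (ContinuousLinearMap.inl ℝ H ℝ) :=
    (hh.continuous_fderiv one_ne_zero).clm_comp continuous_const
  have hsec (x : H) : Continuous (h x) :=
    hh.continuous.comp (Continuous.prodMk_right x)
  have hsec' (x : H) : Continuous fun t : ℝ =>
      (fderiv ℝ (Function.uncurry h) (x, t)).comp (ContinuousLinearMap.inl ℝ H ℝ) :=
    hF'.comp (Continuous.prodMk_right x)
  obtain ⟨C, hC⟩ := (isCompact_uIcc (a := a) (b := b)).exists_bound_of_continuousOn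
    (hsec' x₀).continuousOn
  have hloc : ∀ᶠ x in nhds x₀, ∀ t ∈ uIcc a b,
      ‖(fderiv ℝ (Function.uncurry h) (x, t)).comp (ContinuousLinearMap.inl ℝ H ℝ)‖
        < C + 1 := by
    refine isCompact_uIcc.eventually_forall_of_forall_eventually fun t ht => ?_
    exact hF'.norm.continuousAt.eventually_lt_const
      ((hC t ht).trans_lt (lt_add_one C))
  refine hasFDerivAt_integral_of_dominated_of_fderiv_le (bound := fun _ => C + 1)
    (F' := fun x t =>
      (fderiv ℝ (Function.uncurry h) (x, t)).comp (ContinuousLinearMap.inl ℝ H ℝ)) hloc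
    (Filter.Eventually.of_forall fun x => (hsec x).aestronglyMeasurable)
    ((hsec x₀).intervalIntegrable a b) (hsec' x₀).aestronglyMeasurable
    (Filter.Eventually.of_forall fun t ht x hx => (hx t (uIoc_subset_uIcc ht)).le)
    intervalIntegrable_const (Filter.Eventually.of_forall fun t _ x _ => ?_)
  exact HasFDerivAt.comp (f := fun y => (y, t)) x
    (hh.differentiable one_ne_zero (x, t)).hasFDerivAt (hasFDerivAt_prodMk_left x t)

/-- An interval integral with fixed endpoints is `Cⁿ` in a parameter when the integrand is
jointly `Cⁿ`. -/
theorem contDiff_intervalIntegral_nat {H : Type u} [NormedAddCommGroup H] [NormedSpace ℝ H]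
    (a b : ℝ) (n : ℕ) {F : Type u} [NormedAddCommGroup F] [NormedSpace ℝ F]
    {h : H → ℝ → F} (hh : ContDiff ℝ n (Function.uncurry h)) :
    ContDiff ℝ n (fun x => ∫ t in a..b, h x t) := by
  induction n generalizing F with
  | zero =>
    exact contDiff_zero.2
      (continuous_parametric_intervalIntegral_of_continuous' hh.continuous a b)
  | succ n ih =>
    rw [Nat.cast_add, Nat.cast_one] at hh ⊢
    refine contDiff_succ_iff_hasFDerivAt.2 ⟨_, ih ?_, fun x =>
      hasFDerivAt_intervalIntegral_of_contDiff (hh.of_le le_add_self) a b x⟩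
    exact (hh.fderiv_right le_rfl).clm_comp contDiff_const

/-- An interval integral with fixed endpoints is smooth in a parameter when the integrand is
jointly smooth. -/
theorem contDiff_intervalIntegral {H F : Type u} [NormedAddCommGroup H] [NormedSpace ℝ H]
    [NormedAddCommGroup F] [NormedSpace ℝ F] {h : H → ℝ → F}
    (hh : ContDiff ℝ (⊤ : ℕ∞) (Function.uncurry h)) (a b : ℝ) :
    ContDiff ℝ (⊤ : ℕ∞) (fun x => ∫ t in a..b, h x t) :=
  contDiff_infty.2 fun n => contDiff_intervalIntegral_nat a b n (contDiff_infty.1 hh n)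

theorem contDiff_integral_comp_add_mul_sq {k : ℝ → ℝ} (hk : ContDiff ℝ (⊤ : ℕ∞) k) :
    ContDiff ℝ (⊤ : ℕ∞)
      (fun p : ℝ × ℝ × ℝ => ∫ z in (0 : ℝ)..p.2.2, k (p.1 + p.2.1 * z ^ 2)) := by
  have hscale (p : ℝ × ℝ × ℝ) : ∫ z in (0 : ℝ)..p.2.2, k (p.1 + p.2.1 * z ^ 2) =
      p.2.2 * ∫ t in (0 : ℝ)..1, k (p.1 + p.2.1 * (p.2.2 * t) ^ 2) := by
    simpa using (intervalIntegral.mul_integral_comp_mul_left (a := 0) (b := 1)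
      (f := fun z => k (p.1 + p.2.1 * z ^ 2)) p.2.2).symm
  simp_rw [hscale]
  refine contDiff_snd.snd.mul (contDiff_intervalIntegral ?_ 0 1)
  refine hk.comp (f := fun q : (ℝ × ℝ × ℝ) × ℝ =>
    q.1.1 + q.1.2.1 * (q.1.2.2 * q.2) ^ 2) ?_
  fun_prop

/-- The `s`-derivative of the family: the contribution of `f` cancels. -/
theorem hasDerivAt_sub_mul_integral_add_mul {f : ℝ → ℝ} (hf : ContDiff ℝ (⊤ : ℕ∞) f)
    (a b d s : ℝ) :
    HasDerivAt (fun t => f (a + b * t ^ 2)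
        - 2 * b * t * (∫ z in (0 : ℝ)..t, deriv f (a + b * z ^ 2)) + d * t)
      (-(2 * b * ∫ z in (0 : ℝ)..s, deriv f (a + b * z ^ 2)) + d) s := by
  have hf' : Continuous (deriv f) := hf.continuous_deriv (by simp)
  have hX : HasDerivAt (fun t : ℝ => a + b * t ^ 2) (b * (2 * s)) s := by
    simpa using ((hasDerivAt_pow 2 s).const_mul b).const_add a
  have hfX : HasDerivAt (fun t => f (a + b * t ^ 2))
      (deriv f (a + b * s ^ 2) * (b * (2 * s))) s :=
    (hf.differentiable (by simp) _).hasDerivAt.comp s hX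
  have hJ : HasDerivAt (fun t => ∫ z in (0 : ℝ)..t, deriv f (a + b * z ^ 2))
      (deriv f (a + b * s ^ 2)) s :=
    (show Continuous fun z : ℝ => deriv f (a + b * z ^ 2) by fun_prop).integral_hasStrictDerivAt
      0 s |>.hasDerivAt
  have hlin : HasDerivAt (fun t : ℝ => 2 * b * t) (2 * b) s := by
    simpa using (hasDerivAt_id s).const_mul (2 * b)
  have hd : HasDerivAt (fun t : ℝ => d * t) d s := by
    simpa using (hasDerivAt_id s).const_mul d
  convert! (hfX.sub (hlin.mul hJ)).add hd using 1
  ring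

theorem stmt0
    (I : Set ℝ) (hIopen : IsOpen I) (hIconn : I.OrdConnected) (hIsub : I ⊆ Set.Ioi 0)
    (c ν μ : ℝ → ℝ)
    (hc : ContDiffOn ℝ (⊤ : ℕ∞) c I) (hν : ContDiffOn ℝ (⊤ : ℕ∞) ν I) (hμ : ContDiffOn ℝ (⊤ : ℕ∞) μ I)
    (hνneg : ∀ u ∈ I, ν u < 0)
    (hνderiv : ∀ u ∈ I, deriv ν u = ((c u - 1) / u) * ν u)
    (hμderiv : ∀ u ∈ I, deriv μ u = -(c u * ν u))
    (f g : ℝ → ℝ) (hf : ContDiff ℝ (⊤ : ℕ∞) f) (hg : ContDiff ℝ (⊤ : ℕ∞) g)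
    (φ : ℝ → ℝ → ℝ)
    (hφ : ∀ u s, φ u s =
      f (μ u + ν u * s ^ 2)
        - 2 * ν u * s * (∫ z in (0:ℝ)..s, deriv f (μ u + ν u * z ^ 2))
        + g u * s) :
    ContDiffOn ℝ (⊤ : ℕ∞) (Function.uncurry φ) (I ×ˢ (Set.univ : Set ℝ)) ∧
      ∀ u ∈ I, ∀ s : ℝ,
        (c u * u - (c u - 1) * s ^ 2) * p22 φ u s
          = 2 * u * (p1 φ u s - s * p12 φ u s) := by
  have hf' : ContDiff ℝ (⊤ : ℕ∞) (deriv f) := (contDiff_infty_iff_deriv.1 hf).2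
  have hJ := contDiff_integral_comp_add_mul_sq hf'
  have hp2 (u s : ℝ) : p2 φ u s =
      -(2 * ν u * ∫ z in (0 : ℝ)..s, deriv f (μ u + ν u * z ^ 2)) + g u := by
    simp only [p2, hφ]
    exact (hasDerivAt_sub_mul_integral_add_mul hf _ _ _ s).deriv
  refine ⟨?_, fun u hu s => ?_⟩
  · have hμ₁ : ContDiffOn ℝ (⊤ : ℕ∞) (fun p : ℝ × ℝ => μ p.1) (I ×ˢ univ) :=
      hμ.comp contDiffOn_fst fun p hp => hp.1
    have hν₁ : ContDiffOn ℝ (⊤ : ℕ∞) (fun p : ℝ × ℝ => ν p.1) (I ×ˢ univ) :=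
      hν.comp contDiffOn_fst fun p hp => hp.1
    have hs : ContDiffOn ℝ (⊤ : ℕ∞) (fun p : ℝ × ℝ => p.2) (I ×ˢ univ) := contDiffOn_snd
    have hint := hJ.comp_contDiffOn (hμ₁.prodMk (hν₁.prodMk hs))
    have hfX := hf.comp_contDiffOn (hμ₁.add (hν₁.mul (hs.pow 2)))
    have hgs := (hg.comp_contDiffOn contDiffOn_fst).mul hs
    refine ((hfX.sub (((contDiffOn_const (c := (2 : ℝ))).mul hν₁).mul hs |>.mul hint)).add
      hgs).congr fun p _ => ?_
    exact hφ p.1 p.2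
  · have hu0 : u ≠ 0 := (hIsub hu).ne'
    have hIu := hIopen.mem_nhds hu
    have hμu : HasDerivAt μ (-(c u * ν u)) u :=
      hμderiv u hu ▸ ((hμ.contDiffAt hIu).differentiableAt (by simp)).hasDerivAt
    have hνu : HasDerivAt ν (((c u - 1) / u) * ν u) u :=
      hνderiv u hu ▸ ((hν.contDiffAt hIu).differentiableAt (by simp)).hasDerivAt
    have hgu : HasDerivAt g (deriv g u) u := (hg.differentiable (by simp) u).hasDerivAt
    obtain ⟨J', hJu⟩ : ∃ J', HasDerivAt
        (fun t => ∫ z in (0 : ℝ)..s, deriv f (μ t + ν t * z ^ 2)) J' u :=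
      ⟨_, (DifferentiableAt.comp (f := fun t => (μ t, ν t, s)) u
        (hJ.differentiable (by simp) (μ u, ν u, s)) (hμu.differentiableAt.prodMk
          (hνu.differentiableAt.prodMk (differentiableAt_const s)))).hasDerivAt⟩
    have hfX := (hf.differentiable (by simp) (μ u + ν u * s ^ 2)).hasDerivAt.comp u
      (hμu.add (hνu.mul_const (s ^ 2)))
    have h22 : p22 φ u s = -(2 * ν u * deriv f (μ u + ν u * s ^ 2)) := by
      simp only [p22, hp2]
      have hcont : Continuous fun z : ℝ => deriv f (μ u + ν u * z ^ 2) :=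
        hf'.continuous.comp (by fun_prop)
      exact (((hcont.integral_hasStrictDerivAt 0 s).hasDerivAt.const_mul
        (2 * ν u)).neg.add_const (g u)).deriv
    have h12 := (((hνu.const_mul 2).mul hJu).neg.add hgu).deriv
    have h1 := ((hfX.sub (((hνu.const_mul 2).mul_const s).mul hJu)).add
      (hgu.mul_const s)).deriv
    have e12 := (congrArg (deriv · u) (funext fun t => hp2 t s)).trans h12
    have e1 := (congrArg (deriv · u) (funext fun t => hφ t s)).trans h1
    change p12 φ u s = _ at e12
    change p1 φ u s = _ at e1
    rw [h22, e12, e1]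
    field_simp
    ring
end

section
/- Let I ⊆ (0,∞) be an open interval, let c : I → ℝ be smooth, let ν : I → ℝ be smooth with ν(u) < 0 and ν'(u) = ((c(u)−1)/u)·ν(u) for all u ∈ I, and let μ : I → ℝ be smooth with μ'(u) = −c(u)·ν(u) for all u ∈ I. Suppose φ : I × ℝ → ℝ is smooth and satisfies (c(u)·u − (c(u)−1)·s²)·φ₂₂(u,s) = 2u·(φ₁(u,s) − s·φ₁₂(u,s)) on I × ℝ. Set w(u,s) = μ(u) + ν(u)s² and ψ(u,s) = φ(u,s) − s·φ₂(u,s). Then the Jacobian determinant of (w, ψ) vanishes identically, i.e. (∂w/∂u)·(∂ψ/∂s) − (∂w/∂s)·(∂ψ/∂u) = 0 on I × ℝ. -/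
open Real Set MeasureTheory intervalIntegral

/-- On an open strip, a smooth function is differentiable at every point. -/
theorem differentiableAt_uncurry_of_contDiffOn {I : Set ℝ} (hI : IsOpen I) {φ : ℝ → ℝ → ℝ}
    (hφ : ContDiffOn ℝ (⊤ : ℕ∞) (Function.uncurry φ) (I ×ˢ (Set.univ : Set ℝ)))
    {u : ℝ} (hu : u ∈ I) (s : ℝ) : DifferentiableAt ℝ (Function.uncurry φ) (u, s) :=
  (hφ.contDiffAt ((hI.prod isOpen_univ).mem_nhds ⟨hu, Set.mem_univ s⟩)).differentiableAt (by simp)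

theorem differentiableAt_fst_of_uncurry {f : ℝ → ℝ → ℝ} {u s : ℝ}
    (h : DifferentiableAt ℝ (Function.uncurry f) (u, s)) :
    DifferentiableAt ℝ (fun t => f t s) u :=
  h.comp (f := fun t : ℝ => (t, s)) u (by fun_prop)

theorem differentiableAt_snd_of_uncurry {f : ℝ → ℝ → ℝ} {u s : ℝ}
    (h : DifferentiableAt ℝ (Function.uncurry f) (u, s)) :
    DifferentiableAt ℝ (fun t => f u t) s :=
  h.comp (f := fun t : ℝ => (u, t)) s (by fun_prop)

theorem p2_eq_fderiv {φ : ℝ → ℝ → ℝ} {u s : ℝ}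
    (h : DifferentiableAt ℝ (Function.uncurry φ) (u, s)) :
    p2 φ u s = fderiv ℝ (Function.uncurry φ) (u, s) (0, 1) :=
  (h.hasFDerivAt.comp_hasDerivAt (f := fun t : ℝ => (u, t)) s
    ((hasDerivAt_const s u).prodMk (hasDerivAt_id s))).deriv

theorem contDiffOn_uncurry_p2 {I : Set ℝ} (hI : IsOpen I) {φ : ℝ → ℝ → ℝ}
    (hφ : ContDiffOn ℝ (⊤ : ℕ∞) (Function.uncurry φ) (I ×ˢ (Set.univ : Set ℝ))) :
    ContDiffOn ℝ (⊤ : ℕ∞) (Function.uncurry (p2 φ)) (I ×ˢ (Set.univ : Set ℝ)) :=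
  ((hφ.fderiv_of_isOpen (hI.prod isOpen_univ) (m := (⊤ : ℕ∞)) (by simp)).clm_apply
    contDiffOn_const).congr fun x hx =>
      p2_eq_fderiv (differentiableAt_uncurry_of_contDiffOn hI hφ hx.1 x.2)

theorem stmt1
    (I : Set ℝ) (hIopen : IsOpen I) (hIconn : I.OrdConnected) (hIsub : I ⊆ Set.Ioi 0)
    (c ν μ : ℝ → ℝ)
    (hc : ContDiffOn ℝ (⊤ : ℕ∞) c I) (hν : ContDiffOn ℝ (⊤ : ℕ∞) ν I) (hμ : ContDiffOn ℝ (⊤ : ℕ∞) μ I)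
    (hνneg : ∀ u ∈ I, ν u < 0)
    (hνderiv : ∀ u ∈ I, deriv ν u = ((c u - 1) / u) * ν u)
    (hμderiv : ∀ u ∈ I, deriv μ u = -(c u * ν u))
    (φ : ℝ → ℝ → ℝ)
    (hφ : ContDiffOn ℝ (⊤ : ℕ∞) (Function.uncurry φ) (I ×ˢ (Set.univ : Set ℝ)))
    (hPDE : ∀ u ∈ I, ∀ s : ℝ,
      (c u * u - (c u - 1) * s ^ 2) * p22 φ u s
        = 2 * u * (p1 φ u s - s * p12 φ u s))
    (w ψ : ℝ → ℝ → ℝ)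
    (hw : ∀ u s, w u s = μ u + ν u * s ^ 2)
    (hψ : ∀ u s, ψ u s = φ u s - s * p2 φ u s) :
    ∀ u ∈ I, ∀ s : ℝ,
      p1 w u s * p2 ψ u s - p2 w u s * p1 ψ u s = 0 := by
  intro u hu s
  have hu0 : u ≠ 0 := (hIsub hu).ne'
  have hφd := differentiableAt_uncurry_of_contDiffOn hIopen hφ hu s
  have hpd := differentiableAt_uncurry_of_contDiffOn hIopen (contDiffOn_uncurry_p2 hIopen hφ) hu s
  have hνd : DifferentiableAt ℝ ν u :=
    (hν.contDiffAt (hIopen.mem_nhds hu)).differentiableAt (by simp)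
  have hμd : DifferentiableAt ℝ μ u :=
    (hμ.contDiffAt (hIopen.mem_nhds hu)).differentiableAt (by simp)
  obtain rfl : w = fun u s => μ u + ν u * s ^ 2 := funext₂ hw
  obtain rfl : ψ = fun u s => φ u s - s * p2 φ u s := funext₂ hψ
  have hw1 : p1 (fun u s => μ u + ν u * s ^ 2) u s
      = -(c u * ν u) + (c u - 1) / u * ν u * s ^ 2 := by
    rw [← hμderiv u hu, ← hνderiv u hu]
    exact (hμd.hasDerivAt.add (hνd.hasDerivAt.mul_const (s ^ 2))).deriv
  have hw2 : p2 (fun u s => μ u + ν u * s ^ 2) u s = 2 * ν u * s := by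
    refine ((((hasDerivAt_id s).pow 2).const_mul (ν u)).const_add (μ u)).deriv.trans ?_
    simp
    ring
  have hψ1 : p1 (fun u s => φ u s - s * p2 φ u s) u s = p1 φ u s - s * p12 φ u s :=
    ((differentiableAt_fst_of_uncurry hφd).hasDerivAt.sub
      ((differentiableAt_fst_of_uncurry hpd).hasDerivAt.const_mul s)).deriv
  have hψ2 : p2 (fun u s => φ u s - s * p2 φ u s) u s = -(s * p22 φ u s) := by
    refine ((differentiableAt_snd_of_uncurry hφd).hasDerivAt.sub
      ((hasDerivAt_id s).mul (differentiableAt_snd_of_uncurry hpd).hasDerivAt)).deriv.trans ?_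
    simp only [id, p22, p2]
    ring
  rw [hw1, hw2, hψ1, hψ2]
  field_simp
  linear_combination ν u * s * hPDE u hu s
end

section
/- Let I ⊆ (0,∞) be an open interval, let c : I → ℝ be smooth with c(u) ≠ 0 for all u ∈ I, let ν : I → ℝ be smooth with ν(u) < 0 and ν'(u) = ((c(u)−1)/u)·ν(u) for all u ∈ I, and let μ : I → ℝ be smooth with μ'(u) = −c(u)·ν(u) for all u ∈ I. Suppose φ : I × ℝ → ℝ is smooth and satisfies (c(u)·u − (c(u)−1)·s²)·φ₂₂(u,s) = 2u·(φ₁(u,s) − s·φ₁₂(u,s)) on I × ℝ. Then for every point (u₀,s₀) ∈ I × ℝ there exist an open neighborhood V of (u₀,s₀) in I × ℝ, an open interval J ⊆ ℝ, and a smooth function f : J → ℝ such that μ(u) + ν(u)s² ∈ J and φ(u,s) − s·φ₂(u,s) = f(μ(u) + ν(u)s²) for all (u,s) ∈ V. -/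
open Real Set MeasureTheory intervalIntegral

open scoped Topology ContDiff in
/-- If `h` is a smooth submersion at `p₀`, as witnessed by a complementary linear map `ℓ`, and the
derivative of `ψ` vanishes on the kernel of the derivative of `h`, then `ψ` is locally a smooth
function of `h`. -/
theorem exists_contDiffOn_factor_of_ker_fderiv_le
    {E F K G : Type*} [NormedAddCommGroup E] [NormedSpace ℝ E] [CompleteSpace E]
    [NormedAddCommGroup F] [NormedSpace ℝ F] [NormedAddCommGroup K] [NormedSpace ℝ K]
    [NormedAddCommGroup G] [NormedSpace ℝ G]
    {Ω : Set E} (hΩ : IsOpen Ω) {h : E → F} {ψ : E → G}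
    (hh : ContDiffOn ℝ ∞ h Ω) (hψ : ContDiffOn ℝ ∞ ψ Ω) {p₀ : E} (hp₀ : p₀ ∈ Ω)
    (ℓ : E →L[ℝ] K) (hinv : ((fderiv ℝ h p₀).prod ℓ).IsInvertible)
    (hker : ∀ p ∈ Ω, ∀ v, fderiv ℝ h p v = 0 → fderiv ℝ ψ p v = 0) :
    ∃ V : Set E, IsOpen V ∧ p₀ ∈ V ∧ V ⊆ Ω ∧ ∃ r > 0, ∃ f : F → G,
      ContDiffOn ℝ ∞ f (Metric.ball (h p₀) r) ∧
        ∀ p ∈ V, h p ∈ Metric.ball (h p₀) r ∧ ψ p = f (h p) := by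
  have hhd : ∀ p ∈ Ω, ContDiffAt ℝ ∞ h p := fun p hp => hh.contDiffAt (hΩ.mem_nhds hp)
  have hψd : ∀ p ∈ Ω, ContDiffAt ℝ ∞ ψ p := fun p hp => hψ.contDiffAt (hΩ.mem_nhds hp)
  have hΦ : ∀ p ∈ Ω, ContDiffAt ℝ ∞ (fun p => (h p, ℓ p)) p := fun p hp =>
    (hhd p hp).prodMk ℓ.contDiff.contDiffAt
  have hΦ' : ∀ p ∈ Ω, HasFDerivAt (fun p => (h p, ℓ p)) ((fderiv ℝ h p).prod ℓ) p := fun p hp =>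
    ((hhd p hp).differentiableAt (by simp)).hasFDerivAt.prodMk ℓ.hasFDerivAt
  obtain ⟨A, hA⟩ := hinv
  have hA₀ : HasFDerivAt (fun p => (h p, ℓ p)) (A : E →L[ℝ] F × K) p₀ := hA ▸ hΦ' p₀ hp₀
  set e := (hΦ p₀ hp₀).toOpenPartialHomeomorph _ hA₀ (by simp)
  have hecoe : ∀ p, e p = (h p, ℓ p) := fun p => rfl
  have hesrc : p₀ ∈ e.source := (hΦ p₀ hp₀).mem_toOpenPartialHomeomorph_source hA₀ (by simp)
  have hcont : ContinuousAt (fun p => (fderiv ℝ h p).prod ℓ) p₀ := by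
    have h1 : ContinuousAt (fderiv ℝ h) p₀ :=
      (hh.continuousOn_fderiv_of_isOpen hΩ (by simp)).continuousAt (hΩ.mem_nhds hp₀)
    exact (ContinuousLinearMap.prodₗᵢ ℝ (𝕜 := ℝ) (E := E) (F := F)
      (G := K)).continuous.continuousAt.comp (h1.prodMk continuousAt_const)
  have hinvnhds : ∀ᶠ p in 𝓝 p₀, p ∈ Ω ∧ ((fderiv ℝ h p).prod ℓ).IsInvertible := by
    refine Filter.Eventually.and (hΩ.mem_nhds hp₀) ?_
    refine hcont.eventually (p := ContinuousLinearMap.IsInvertible) ?_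
    dsimp only
    rw [← hA]
    exact A.nhds
  have htgt : ∀ᶠ q in 𝓝 (e p₀), q ∈ e.target ∧ e.symm q ∈ Ω ∧
      ((fderiv ℝ h (e.symm q)).prod ℓ).IsInvertible := by
    refine Filter.Eventually.and (e.open_target.mem_nhds (e.map_source hesrc)) ?_
    have := e.continuousAt_symm (e.map_source hesrc)
    rw [ContinuousAt, e.left_inv hesrc] at this
    exact this.eventually hinvnhds
  obtain ⟨r, hr, hball⟩ := Metric.eventually_nhds_iff_ball.1 htgt
  have hsymm : ∀ q ∈ Metric.ball (e p₀) r, ContDiffAt ℝ ∞ (ψ ∘ e.symm) q := by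
    intro q hq
    obtain ⟨hqt, hqΩ, B, hB⟩ := hball q hq
    exact (hψd _ hqΩ).comp q (e.contDiffAt_symm hqt (f₀' := B) (hB ▸ hΦ' _ hqΩ) (hΦ _ hqΩ))
  have hzero : ∀ q ∈ Metric.ball (e p₀) r, ∀ w : K, fderiv ℝ (ψ ∘ e.symm) q (0, w) = 0 := by
    intro q hq w
    obtain ⟨hqt, hqΩ, B, hB⟩ := hball q hq
    have hs : HasFDerivAt e.symm (B.symm : F × K →L[ℝ] E) q :=
      e.hasFDerivAt_symm hqt (hB ▸ hΦ' _ hqΩ)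
    rw [(((hψd _ hqΩ).differentiableAt (by simp)).hasFDerivAt.comp q hs).fderiv]
    refine hker _ hqΩ _ ?_
    have : ((fderiv ℝ h (e.symm q)).prod ℓ) (B.symm (0, w)) = (0, w) := by
      rw [← hB]; simp
    exact congrArg Prod.fst this
  have hmem : ∀ {t : F} {k : K}, t ∈ Metric.ball (h p₀) r → k ∈ Metric.ball (ℓ p₀) r →
      (t, k) ∈ Metric.ball (e p₀) r := by
    intro t k ht hk
    rw [hecoe, ← ball_prod_same]
    exact ⟨ht, hk⟩
  refine ⟨e.source ∩ e ⁻¹' Metric.ball (e p₀) r, e.isOpen_inter_preimage Metric.isOpen_ball,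
    ⟨hesrc, Metric.mem_ball_self hr⟩, ?_, r, hr, fun t => (ψ ∘ e.symm) (t, ℓ p₀), ?_, ?_⟩
  · rintro p ⟨hp, hpb⟩
    have := (hball _ hpb).2.1
    rwa [e.left_inv hp] at this
  · intro t ht
    exact ((hsymm _ (hmem ht (Metric.mem_ball_self hr))).comp t
      (contDiffAt_id.prodMk contDiffAt_const)).contDiffWithinAt
  · rintro p ⟨hp, hpb⟩
    have hpb' : h p ∈ Metric.ball (h p₀) r ∧ ℓ p ∈ Metric.ball (ℓ p₀) r := by
      have : e p ∈ Metric.ball (e p₀) r := hpb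
      rwa [hecoe, hecoe, ← ball_prod_same] at this
    refine ⟨hpb'.1, ?_⟩
    have hder : ∀ k ∈ Metric.ball (ℓ p₀) r,
        HasFDerivAt (fun k => (ψ ∘ e.symm) (h p, k)) (0 : K →L[ℝ] G) k := by
      intro k hk
      have hb := hmem hpb'.1 hk
      have := ((hsymm _ hb).differentiableAt (by simp)).hasFDerivAt.comp k
        ((hasFDerivAt_const (h p) k).prodMk (hasFDerivAt_id k))
      refine this.congr_fderiv ?_
      ext w
      exact hzero _ hb w
    have := (convex_ball (ℓ p₀) r).is_const_of_fderivWithin_eq_zero (𝕜 := ℝ)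
      (fun k hk => (hder k hk).differentiableAt.differentiableWithinAt)
      (fun k hk => ((hder k hk).hasFDerivWithinAt).fderivWithin
        (Metric.isOpen_ball.uniqueDiffWithinAt hk)) hpb'.2 (Metric.mem_ball_self hr)
    calc ψ p = ψ (e.symm (e p)) := by rw [e.left_inv hp]
      _ = (ψ ∘ e.symm) (h p, ℓ p₀) := this

/-- Partial derivatives in the first variable as total derivatives. -/
theorem deriv_fst_eq_fderiv {g : ℝ × ℝ → ℝ} {u s : ℝ} (hg : DifferentiableAt ℝ g (u, s)) :
    deriv (fun t => g (t, s)) u = fderiv ℝ g (u, s) (1, 0) :=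
  (hg.hasFDerivAt.comp_hasDerivAt (f := fun t => (t, s)) u
    ((hasDerivAt_id u).prodMk (hasDerivAt_const u s))).deriv

/-- Partial derivatives in the second variable as total derivatives. -/
theorem deriv_snd_eq_fderiv {g : ℝ × ℝ → ℝ} {u s : ℝ} (hg : DifferentiableAt ℝ g (u, s)) :
    deriv (fun t => g (u, t)) s = fderiv ℝ g (u, s) (0, 1) :=
  (hg.hasFDerivAt.comp_hasDerivAt (f := fun t => (u, t)) s
    ((hasDerivAt_const s u).prodMk (hasDerivAt_id s))).deriv

/-- A linear form on `ℝ × ℝ` in coordinates. -/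
theorem apply_eq_fst_mul_add_snd_mul (L : ℝ × ℝ →L[ℝ] ℝ) (v : ℝ × ℝ) :
    L v = v.1 * L (1, 0) + v.2 * L (0, 1) := by
  have : v = v.1 • ((1, 0) : ℝ × ℝ) + v.2 • ((0, 1) : ℝ × ℝ) := by ext <;> simp
  conv_lhs => rw [this, map_add, map_smul, map_smul]
  rfl

/-- An injective continuous linear endomorphism of `ℝ × ℝ` is invertible. -/
theorem isInvertible_of_forall_eq_zero (L : ℝ × ℝ →L[ℝ] ℝ × ℝ) (hL : ∀ v, L v = 0 → v = 0) :
    L.IsInvertible :=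
  ⟨(LinearEquiv.ofInjectiveEndo (L : ℝ × ℝ →ₗ[ℝ] ℝ × ℝ)
    ((injective_iff_map_eq_zero _).2 hL)).toContinuousLinearEquiv, by ext <;> rfl⟩

theorem stmt2
    (I : Set ℝ) (hIopen : IsOpen I) (hIconn : I.OrdConnected) (hIsub : I ⊆ Set.Ioi 0)
    (c ν μ : ℝ → ℝ)
    (hc : ContDiffOn ℝ (⊤ : ℕ∞) c I) (hcne : ∀ u ∈ I, c u ≠ 0)
    (hν : ContDiffOn ℝ (⊤ : ℕ∞) ν I) (hμ : ContDiffOn ℝ (⊤ : ℕ∞) μ I)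
    (hνneg : ∀ u ∈ I, ν u < 0)
    (hνderiv : ∀ u ∈ I, deriv ν u = ((c u - 1) / u) * ν u)
    (hμderiv : ∀ u ∈ I, deriv μ u = -(c u * ν u))
    (φ : ℝ → ℝ → ℝ)
    (hφ : ContDiffOn ℝ (⊤ : ℕ∞) (Function.uncurry φ) (I ×ˢ (Set.univ : Set ℝ)))
    (hPDE : ∀ u ∈ I, ∀ s : ℝ,
      (c u * u - (c u - 1) * s ^ 2) * p22 φ u s
        = 2 * u * (p1 φ u s - s * p12 φ u s)) :
    ∀ u₀ ∈ I, ∀ s₀ : ℝ,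
      ∃ V : Set (ℝ × ℝ), IsOpen V ∧ (u₀, s₀) ∈ V ∧ V ⊆ I ×ˢ (Set.univ : Set ℝ) ∧
        ∃ J : Set ℝ, IsOpen J ∧ J.OrdConnected ∧
          ∃ f : ℝ → ℝ, ContDiffOn ℝ (⊤ : ℕ∞) f J ∧
            ∀ p ∈ V, μ p.1 + ν p.1 * p.2 ^ 2 ∈ J ∧
              φ p.1 p.2 - p.2 * p2 φ p.1 p.2 = f (μ p.1 + ν p.1 * p.2 ^ 2) := by
  intro u₀ hu₀ s₀
  set Ω : Set (ℝ × ℝ) := I ×ˢ (Set.univ : Set ℝ)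
  have hΩ : IsOpen Ω := hIopen.prod isOpen_univ
  have hφd : ∀ p ∈ Ω, DifferentiableAt ℝ (Function.uncurry φ) p := fun p hp =>
    (hφ.contDiffAt (hΩ.mem_nhds hp)).differentiableAt (by simp)
  have hp2 : ContDiffOn ℝ (⊤ : ℕ∞) (fun p : ℝ × ℝ => p2 φ p.1 p.2) Ω :=
    ((hφ.fderiv_of_isOpen hΩ (m := (⊤ : ℕ∞)) (by simp)).clm_apply contDiffOn_const).congr
      (fun p hp => deriv_snd_eq_fderiv (hφd p hp))
  have hp2d : ∀ p ∈ Ω, DifferentiableAt ℝ (fun p : ℝ × ℝ => p2 φ p.1 p.2) p := fun p hp =>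
    (hp2.contDiffAt (hΩ.mem_nhds hp)).differentiableAt (by simp)
  have hψ : ContDiffOn ℝ (⊤ : ℕ∞) (fun p : ℝ × ℝ => φ p.1 p.2 - p.2 * p2 φ p.1 p.2) Ω :=
    hφ.sub (contDiffOn_snd.mul hp2)
  have hfst : Set.MapsTo Prod.fst Ω I := fun p hp => hp.1
  have hh : ContDiffOn ℝ (⊤ : ℕ∞) (fun p : ℝ × ℝ => μ p.1 + ν p.1 * p.2 ^ 2) Ω :=
    (hμ.comp contDiffOn_fst hfst).add
      ((hν.comp contDiffOn_fst hfst).mul (contDiffOn_snd.pow 2))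
  have hdh : ∀ p ∈ Ω, ∀ v, fderiv ℝ (fun p : ℝ × ℝ => μ p.1 + ν p.1 * p.2 ^ 2) p v =
      v.1 * (-(c p.1 * ν p.1) + (c p.1 - 1) / p.1 * ν p.1 * p.2 ^ 2)
        + v.2 * (2 * ν p.1 * p.2) := by
    rintro ⟨u, s⟩ hp v
    have hd := (hh.contDiffAt (hΩ.mem_nhds hp)).differentiableAt (by simp)
    have hμu : HasDerivAt μ (-(c u * ν u)) u := by
      rw [← hμderiv u hp.1]
      exact ((hμ.contDiffAt (hIopen.mem_nhds hp.1)).differentiableAt (by simp)).hasDerivAt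
    have hνu : HasDerivAt ν ((c u - 1) / u * ν u) u := by
      rw [← hνderiv u hp.1]
      exact ((hν.contDiffAt (hIopen.mem_nhds hp.1)).differentiableAt (by simp)).hasDerivAt
    have hu : deriv (fun t => μ t + ν t * s ^ 2) u = _ := (hμu.add (hνu.mul_const (s ^ 2))).deriv
    have hs : deriv (fun t => μ u + ν u * t ^ 2) s = _ :=
      (((hasDerivAt_pow 2 s).const_mul (ν u)).const_add (μ u)).deriv
    rw [apply_eq_fst_mul_add_snd_mul, ← deriv_fst_eq_fderiv hd, ← deriv_snd_eq_fderiv hd]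
    dsimp only
    rw [hu, hs]
    push_cast
    ring
  have hdψ : ∀ p ∈ Ω, ∀ v, fderiv ℝ (fun p : ℝ × ℝ => φ p.1 p.2 - p.2 * p2 φ p.1 p.2) p v =
      v.1 * (p1 φ p.1 p.2 - p.2 * p12 φ p.1 p.2) - v.2 * (p.2 * p22 φ p.1 p.2) := by
    rintro ⟨u, s⟩ hp v
    have hd := (hψ.contDiffAt (hΩ.mem_nhds hp)).differentiableAt (by simp)
    have hφ1 : HasDerivAt (fun t => φ t s) (p1 φ u s) u :=
      ((hφd _ hp).comp (f := fun t => (t, s)) u (by fun_prop)).hasDerivAt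
    have hφ2 : HasDerivAt (fun t => φ u t) (p2 φ u s) s :=
      ((hφd _ hp).comp (f := fun t => (u, t)) s (by fun_prop)).hasDerivAt
    have hφ12 : HasDerivAt (fun t => p2 φ t s) (p12 φ u s) u :=
      ((hp2d _ hp).comp (f := fun t => (t, s)) u (by fun_prop)).hasDerivAt
    have hφ22 : HasDerivAt (fun t => p2 φ u t) (p22 φ u s) s :=
      ((hp2d _ hp).comp (f := fun t => (u, t)) s (by fun_prop)).hasDerivAt
    have hu : deriv (fun t => φ t s - s * p2 φ t s) u = _ := (hφ1.sub (hφ12.const_mul s)).deriv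
    have hs : deriv (fun t => φ u t - t * p2 φ u t) s = _ :=
      (hφ2.sub ((hasDerivAt_id' s).mul hφ22)).deriv
    rw [apply_eq_fst_mul_add_snd_mul, ← deriv_fst_eq_fderiv hd, ← deriv_snd_eq_fderiv hd]
    dsimp only
    rw [hu, hs]
    ring
  have hker : ∀ p ∈ Ω, ∀ v, fderiv ℝ (fun p : ℝ × ℝ => μ p.1 + ν p.1 * p.2 ^ 2) p v = 0 →
      fderiv ℝ (fun p : ℝ × ℝ => φ p.1 p.2 - p.2 * p2 φ p.1 p.2) p v = 0 := by
    rintro ⟨u, s⟩ hp v hv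
    rw [hdh _ hp] at hv
    rw [hdψ _ hp]
    have hu : u ≠ 0 := (hIsub hp.1).ne'
    have hνu : ν u ≠ 0 := (hνneg u hp.1).ne
    have hpde := hPDE u hp.1 s
    dsimp only at hv ⊢
    refine (mul_eq_zero.1 ?_).resolve_left (mul_ne_zero (mul_ne_zero two_ne_zero hu) hνu)
    field_simp at hv
    linear_combination (-(ν u * v.1)) * hpde - p22 φ u s * hv
  have hp₀ : ((u₀, s₀) : ℝ × ℝ) ∈ Ω := ⟨hu₀, Set.mem_univ _⟩
  have hν₀ : ν u₀ ≠ 0 := (hνneg u₀ hu₀).ne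
  obtain ⟨ℓ, hℓ⟩ : ∃ ℓ : ℝ × ℝ →L[ℝ] ℝ,
      ((fderiv ℝ (fun p : ℝ × ℝ => μ p.1 + ν p.1 * p.2 ^ 2) (u₀, s₀)).prod ℓ).IsInvertible := by
    by_cases hs : s₀ = 0
    · refine ⟨ContinuousLinearMap.snd ℝ ℝ ℝ, isInvertible_of_forall_eq_zero _ fun v hv => ?_⟩
      obtain ⟨h1, h2⟩ := Prod.mk.inj hv
      rw [ContinuousLinearMap.coe_coe, hdh _ hp₀] at h1
      replace h2 : v.2 = 0 := h2
      have := hcne u₀ hu₀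
      simp_all [Prod.ext_iff]
    · refine ⟨ContinuousLinearMap.fst ℝ ℝ ℝ, isInvertible_of_forall_eq_zero _ fun v hv => ?_⟩
      obtain ⟨h1, h2⟩ := Prod.mk.inj hv
      rw [ContinuousLinearMap.coe_coe, hdh _ hp₀] at h1
      replace h2 : v.1 = 0 := h2
      simp_all [Prod.ext_iff]
  obtain ⟨V, hVo, hV₀, hVΩ, r, -, f, hf, hfac⟩ :=
    exists_contDiffOn_factor_of_ker_fderiv_le hΩ hh hψ hp₀ ℓ hℓ hker
  exact ⟨V, hVo, hV₀, hVΩ, _, Metric.isOpen_ball, (convex_ball _ r).ordConnected, f, hf, hfac⟩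
end

section
/- Let λ > 0 and b₀ > 0, and let Ω = {(u,s) ∈ ℝ² : 0 < u < b₀ and s² < u}. Suppose φ : Ω → ℝ is smooth and satisfies (λu − (λ−1)s²)·φ₂₂(u,s) = 2u·(φ₁(u,s) − s·φ₁₂(u,s)) on Ω. Then there exist a smooth function f : (0, b₀^λ) → ℝ and a smooth function g : (0, b₀) → ℝ such that φ(u,s) = f(u^λ − u^{λ−1}s²) + 2u^{λ−1}·s·∫₀ˢ f'(u^λ − u^{λ−1}z²) dz + g(u)·s for all (u,s) ∈ Ω (note that u^λ − u^{λ−1}z² = u^{λ−1}(u − z²) ∈ (0, b₀^λ) for all z between 0 and s when (u,s) ∈ Ω). -/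
open Real Set MeasureTheory intervalIntegral

section PartialDerivatives

variable {Ω : Set (ℝ × ℝ)} {G : ℝ → ℝ → ℝ}

/-- On an open set, the total derivative of a smooth function is given by its partial derivatives. -/
lemma hasFDerivAt_uncurry_of_contDiffOn (hΩ : IsOpen Ω)
    (hG : ContDiffOn ℝ (⊤ : ℕ∞) (Function.uncurry G) Ω) {u s : ℝ} (h : (u, s) ∈ Ω) :
    HasFDerivAt (Function.uncurry G)
      (p1 G u s • ContinuousLinearMap.fst ℝ ℝ ℝ + p2 G u s • ContinuousLinearMap.snd ℝ ℝ ℝ)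
      (u, s) := by
  have hd : HasFDerivAt (Function.uncurry G) (fderiv ℝ (Function.uncurry G) (u, s)) (u, s) :=
    ((hG.contDiffAt (hΩ.mem_nhds h)).differentiableAt (by simp)).hasFDerivAt
  have h1 : p1 G u s = fderiv ℝ (Function.uncurry G) (u, s) (1, 0) :=
    (hd.comp_hasDerivAt (f := fun t => (t, s)) u
      ((hasDerivAt_id u).prodMk (hasDerivAt_const u s))).deriv
  have h2 : p2 G u s = fderiv ℝ (Function.uncurry G) (u, s) (0, 1) :=
    (hd.comp_hasDerivAt (f := fun t => (u, t)) s
      ((hasDerivAt_const s u).prodMk (hasDerivAt_id s))).deriv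
  convert hd using 1
  ext <;> simp [h1, h2]

/-- The chain rule along a curve, in terms of partial derivatives. -/
lemma hasDerivAt_curve_of_contDiffOn (hΩ : IsOpen Ω)
    (hG : ContDiffOn ℝ (⊤ : ℕ∞) (Function.uncurry G) Ω) {x y : ℝ → ℝ} {x' y' t : ℝ}
    (h : (x t, y t) ∈ Ω) (hx : HasDerivAt x x' t) (hy : HasDerivAt y y' t) :
    HasDerivAt (fun r => G (x r) (y r)) (p1 G (x t) (y t) * x' + p2 G (x t) (y t) * y') t := by
  have := (hasFDerivAt_uncurry_of_contDiffOn hΩ hG h).comp_hasDerivAt (f := fun r => (x r, y r)) t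
    (hx.prodMk hy)
  exact this.congr_deriv (by simp)

lemma contDiffOn_uncurry_p2_s4 (hΩ : IsOpen Ω)
    (hG : ContDiffOn ℝ (⊤ : ℕ∞) (Function.uncurry G) Ω) :
    ContDiffOn ℝ (⊤ : ℕ∞) (Function.uncurry (p2 G)) Ω := by
  have h : ContDiffOn ℝ (⊤ : ℕ∞)
      (fun p => fderiv ℝ (Function.uncurry G) p ((0 : ℝ), (1 : ℝ))) Ω :=
    (hG.fderiv_of_isOpen hΩ (by simp)).clm_apply contDiffOn_const
  refine h.congr ?_
  rintro ⟨u, s⟩ hp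
  change p2 G u s = fderiv ℝ (Function.uncurry G) (u, s) (0, 1)
  rw [(hasFDerivAt_uncurry_of_contDiffOn hΩ hG hp).fderiv]
  simp

end PartialDerivatives

section Characteristics

variable {l b₀ u s : ℝ}

lemma mul_sub_sq_pos (hl : 0 < l) (hs : s ^ 2 < u) :
    0 < l * u - (l - 1) * s ^ 2 := by
  nlinarith [sq_nonneg s, mul_pos hl (sub_pos.2 hs)]

lemma rpow_sub_rpow_mul_sq_mem_Ioo (hl : 0 < l) (hu : 0 < u) (hub : u < b₀) (hs : s ^ 2 < u) :
    u ^ l - u ^ (l - 1) * s ^ 2 ∈ Ioo 0 (b₀ ^ l) := by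
  have e : u ^ l = u ^ (l - 1) * u := by
    rw [← rpow_add_one hu.ne']; simp
  have hp : 0 < u ^ (l - 1) := rpow_pos_of_pos hu _
  have hlt : u ^ l < b₀ ^ l := rpow_lt_rpow hu.le hub hl
  constructor
  · rw [e]; nlinarith
  · nlinarith [mul_nonneg hp.le (sq_nonneg s)]

/-- A smooth function annihilated by `2us ∂₁ + (lu - (l-1)s²) ∂₂` depends only on
`u ^ l - u ^ (l - 1) * s ^ 2`. -/
lemma eq_of_characteristic (hl : 0 < l) {Ω : Set (ℝ × ℝ)} (ho : IsOpen Ω)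
    (hΩ : Ω = {p : ℝ × ℝ | 0 < p.1 ∧ p.1 < b₀ ∧ p.2 ^ 2 < p.1})
    {ψ : ℝ → ℝ → ℝ} (hψ : ContDiffOn ℝ (⊤ : ℕ∞) (Function.uncurry ψ) Ω)
    (hchar : ∀ u s : ℝ, (u, s) ∈ Ω →
      2 * u * s * p1 ψ u s + (l * u - (l - 1) * s ^ 2) * p2 ψ u s = 0)
    (h : (u, s) ∈ Ω) :
    ψ u s = ψ ((u ^ l - u ^ (l - 1) * s ^ 2) ^ (1 / l)) 0 := by
  have h' := h
  rw [hΩ] at h'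
  obtain ⟨hu, hub, hs⟩ : 0 < u ∧ u < b₀ ∧ s ^ 2 < u := h'
  have e : u ^ l = u ^ (l - 1) * u := by
    rw [← rpow_add_one hu.ne']; simp
  have hp : 0 < u ^ (l - 1) := rpow_pos_of_pos hu _
  rcases eq_or_ne s 0 with rfl | hs0
  · congr 1
    simp [← rpow_mul hu.le, hl.ne']
  obtain ⟨hc0, -⟩ := rpow_sub_rpow_mul_sq_mem_Ioo hl hu hub hs
  set c := u ^ l - u ^ (l - 1) * s ^ 2 with hc
  set a := c ^ (1 / l) with ha
  have ha0 : 0 < a := rpow_pos_of_pos hc0 _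
  have hal : a ^ l = c := by rw [ha, ← rpow_mul hc0.le]; simp [hl.ne']
  have hcu : c < u ^ l := by
    have : 0 < s ^ 2 := by positivity
    nlinarith [mul_pos hp this]
  have hau : a < u := by
    rw [← hal] at hcu
    exact (rpow_lt_rpow_iff ha0.le hu.le hl).1 hcu
  obtain ⟨ε, hε, hεs⟩ : ∃ ε : ℝ, ε ^ 2 = 1 ∧ ε * |s| = s := by
    rcases abs_cases s with ⟨h, -⟩ | ⟨h, -⟩
    · exact ⟨1, by norm_num, by linarith⟩
    · exact ⟨-1, by norm_num, by linarith⟩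
  have hfac : ∀ t : ℝ, 0 < t → t - c * t ^ (1 - l) = t ^ (1 - l) * (t ^ l - c) := by
    intro t ht
    rw [mul_sub, ← rpow_add ht]
    simp [mul_comm]
  let q : ℝ → ℝ := fun t => t - c * t ^ (1 - l)
  have hq : ∀ t, 0 < t → HasDerivAt q (1 - c * ((1 - l) * t ^ (1 - l - 1))) t := fun t ht =>
    (hasDerivAt_id t).sub ((Real.hasDerivAt_rpow_const (Or.inl ht.ne')).const_mul c)
  have hq0 : ∀ t ∈ Ioc a u, 0 < q t := by
    intro t ht
    have ht0 := ha0.trans ht.1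
    have : c < t ^ l := hal ▸ rpow_lt_rpow ha0.le ht.1 hl
    change 0 < t - c * t ^ (1 - l)
    rw [hfac t ht0]
    exact mul_pos (rpow_pos_of_pos ht0 _) (sub_pos.2 this)
  have hqa : q a = 0 := by
    change a - c * a ^ (1 - l) = 0
    rw [hfac a ha0, hal]; simp
  have hqnn : ∀ t ∈ Icc a u, 0 ≤ q t := by
    intro t ht
    rcases ht.1.eq_or_lt with rfl | h1
    · exact hqa.ge
    · exact (hq0 t ⟨h1, ht.2⟩).le
  have hqu : q u = s ^ 2 := by
    have h1 : u ^ (1 - l) * u ^ (l - 1) = 1 := by rw [← rpow_add hu]; simp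
    change u - c * u ^ (1 - l) = s ^ 2
    rw [hfac u hu, hc]
    linear_combination s ^ 2 * h1
  have hmem : ∀ t ∈ Icc a u, (t, ε * √(q t)) ∈ Ω := by
    intro t ht
    have ht0 := ha0.trans_le ht.1
    rw [hΩ]
    refine ⟨ht0, ht.2.trans_lt hub, ?_⟩
    change (ε * √(q t)) ^ 2 < t
    rw [mul_pow, hε, sq_sqrt (hqnn t ht), one_mul]
    have := mul_pos hc0 (rpow_pos_of_pos ht0 (1 - l))
    change t - c * t ^ (1 - l) < t
    linarith
  have hqc : ContinuousOn q (Icc a u) := fun t ht =>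
    (hq t (ha0.trans_le ht.1)).continuousAt.continuousWithinAt
  have hcont : ContinuousOn (fun t => ψ t (ε * √(q t))) (Icc a u) :=
    hψ.continuousOn.comp (f := fun t => (t, ε * √(q t)))
      (continuousOn_id.prodMk (continuousOn_const.mul hqc.sqrt)) hmem
  have hder : ∀ t ∈ Ioo a u, HasDerivAt (fun t => ψ t (ε * √(q t))) 0 t := by
    intro t ht
    have ht0 := ha0.trans ht.1
    have hqt := hq0 t ⟨ht.1, ht.2.le⟩
    have hsq : √(q t) ≠ 0 := (sqrt_pos.2 hqt).ne'
    have hm := hmem t ⟨ht.1.le, ht.2.le⟩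
    refine (hasDerivAt_curve_of_contDiffOn ho hψ hm (hasDerivAt_id t)
      (((hq t ht0).sqrt hqt.ne').const_mul ε)).congr_deriv ?_
    have hch := hchar _ _ hm
    have hss : √(q t) ^ 2 = t - c * t ^ (1 - l) := sq_sqrt hqt.le
    have hr : t * t ^ (1 - l - 1) = t ^ (1 - l) := by
      rw [mul_comm, ← rpow_add_one ht0.ne', sub_add_cancel]
    rw [mul_pow, hε, hss, ← hr] at hch
    change p1 ψ t (ε * √(q t)) * 1 + p2 ψ t (ε * √(q t)) * _ = 0
    generalize t ^ (1 - l - 1) = R at *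
    generalize √(q t) = S at *
    have hε0 : ε ≠ 0 := by rintro rfl; norm_num at hε
    field_simp
    refine mul_left_cancel₀ (mul_ne_zero ht0.ne' hε0) ?_
    linear_combination hch + t * (1 - c * (R * (1 - l))) * p2 ψ t (ε * S) * hε
  obtain ⟨t, -, ht⟩ := exists_hasDerivAt_eq_slope _ (fun _ => 0) hau hcont hder
  rw [eq_comm, div_eq_zero_iff, or_iff_left (sub_pos.2 hau).ne', sub_eq_zero] at ht
  simpa [hqu, hqa, sqrt_sq_eq_abs, hεs] using ht

end Characteristics

theorem stmt4
    (l b₀ : ℝ) (hl : 0 < l) (hb₀ : 0 < b₀)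
    (Ω : Set (ℝ × ℝ))
    (hΩ : Ω = {p : ℝ × ℝ | 0 < p.1 ∧ p.1 < b₀ ∧ p.2 ^ 2 < p.1})
    (φ : ℝ → ℝ → ℝ)
    (hφ : ContDiffOn ℝ (⊤ : ℕ∞) (Function.uncurry φ) Ω)
    (hPDE : ∀ u s : ℝ, (u, s) ∈ Ω →
      (l * u - (l - 1) * s ^ 2) * p22 φ u s
        = 2 * u * (p1 φ u s - s * p12 φ u s)) :
    ∃ f g : ℝ → ℝ,
      ContDiffOn ℝ (⊤ : ℕ∞) f (Set.Ioo 0 (b₀ ^ l)) ∧ ContDiffOn ℝ (⊤ : ℕ∞) g (Set.Ioo 0 b₀) ∧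
        ∀ u s : ℝ, (u, s) ∈ Ω →
          φ u s =
            f (u ^ l - u ^ (l - 1) * s ^ 2)
              + 2 * u ^ (l - 1) * s *
                  (∫ z in (0:ℝ)..s, deriv f (u ^ l - u ^ (l - 1) * z ^ 2))
              + g u * s := by
  have ho : IsOpen Ω := by
    rw [hΩ]
    exact (isOpen_lt continuous_const continuous_fst).inter
      ((isOpen_lt continuous_fst continuous_const).inter
        (isOpen_lt (continuous_snd.pow 2) continuous_fst))
  have hmem : ∀ u s, (u, s) ∈ Ω ↔ 0 < u ∧ u < b₀ ∧ s ^ 2 < u := by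
    intro u s; rw [hΩ]; rfl
  have hφ2 := contDiffOn_uncurry_p2_s4 ho hφ
  let ψ : ℝ → ℝ → ℝ := fun u s => φ u s - s * p2 φ u s
  have hψ : ContDiffOn ℝ (⊤ : ℕ∞) (Function.uncurry ψ) Ω :=
    hφ.sub (contDiff_snd.contDiffOn.mul hφ2)
  have hψ1 : ∀ u s, (u, s) ∈ Ω → p1 ψ u s = p1 φ u s - s * p12 φ u s := by
    intro u s h
    have h1 := hasDerivAt_curve_of_contDiffOn ho hφ h (hasDerivAt_id u) (hasDerivAt_const u s)
    have h2 := hasDerivAt_curve_of_contDiffOn ho hφ2 h (hasDerivAt_id u) (hasDerivAt_const u s)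
    have h3 := (h1.sub (h2.const_mul s)).deriv
    simp only [id, mul_one, mul_zero, add_zero] at h3
    exact h3
  have hψ2 : ∀ u s, (u, s) ∈ Ω → p2 ψ u s = - s * p22 φ u s := by
    intro u s h
    have h1 := hasDerivAt_curve_of_contDiffOn ho hφ h (hasDerivAt_const s u) (hasDerivAt_id s)
    have h2 := hasDerivAt_curve_of_contDiffOn ho hφ2 h (hasDerivAt_const s u) (hasDerivAt_id s)
    have h3 := (h1.sub ((hasDerivAt_id s).mul h2)).deriv
    simp only [id, mul_one, mul_zero, zero_add, one_mul] at h3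
    have h4 : p2 ψ u s = p2 φ u s - (p2 φ u s + s * p2 (p2 φ) u s) := h3
    rw [h4]
    change _ = -s * p2 (p2 φ) u s
    ring
  have hinv : ∀ u s, (u, s) ∈ Ω → ψ u s = ψ ((u ^ l - u ^ (l - 1) * s ^ 2) ^ (1 / l)) 0 := by
    intro u s h
    refine eq_of_characteristic hl ho hΩ hψ (fun u s h => ?_) h
    rw [hψ1 u s h, hψ2 u s h]
    linear_combination (-s) * hPDE u s h
  have hf : ContDiffOn ℝ (⊤ : ℕ∞) (fun x => ψ (x ^ (1 / l)) 0) (Ioo 0 (b₀ ^ l)) := by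
    refine hψ.comp (f := fun x : ℝ => (x ^ (1 / l), (0 : ℝ))) (ContDiffOn.prodMk ?_ contDiffOn_const) ?_
    · exact contDiffOn_id.rpow_const_of_ne (fun x hx => hx.1.ne')
    · intro x hx
      have h0 : 0 < x ^ (1 / l) := rpow_pos_of_pos hx.1 _
      refine (hmem _ _).2 ⟨h0, ?_, by simpa using h0⟩
      have := rpow_lt_rpow hx.1.le hx.2 (one_div_pos.2 hl)
      rwa [← rpow_mul hb₀.le, mul_one_div_cancel hl.ne', rpow_one] at this
  set f : ℝ → ℝ := fun x => ψ (x ^ (1 / l)) 0 with hfdef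
  have hf' : ContinuousOn (deriv f) (Ioo 0 (b₀ ^ l)) :=
    hf.continuousOn_deriv_of_isOpen isOpen_Ioo (by simp)
  have hfd : ∀ x ∈ Ioo 0 (b₀ ^ l), HasDerivAt f (deriv f x) x := fun x hx =>
    ((hf.contDiffAt (isOpen_Ioo.mem_nhds hx)).differentiableAt (by simp)).hasDerivAt
  have hφ22 : ∀ u s, (u, s) ∈ Ω →
      p22 φ u s = 2 * u ^ (l - 1) * deriv f (u ^ l - u ^ (l - 1) * s ^ 2) := by
    intro u s h
    obtain ⟨hu, hub, hs⟩ := (hmem u s).1 h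
    have hw : HasDerivAt (fun t : ℝ => t ^ l - t ^ (l - 1) * s ^ 2)
        (l * u ^ (l - 1) - (l - 1) * u ^ (l - 1 - 1) * s ^ 2) u :=
      (Real.hasDerivAt_rpow_const (Or.inl hu.ne')).sub
        ((Real.hasDerivAt_rpow_const (Or.inl hu.ne')).mul_const _)
    have hfw := (hfd _ (rpow_sub_rpow_mul_sq_mem_Ioo hl hu hub hs)).comp u hw
    have hev : (fun t => ψ t s) =ᶠ[nhds u] f ∘ (fun t : ℝ => t ^ l - t ^ (l - 1) * s ^ 2) := by
      have hc : ContinuousAt (fun t : ℝ => (t, s)) u := by fun_prop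
      filter_upwards [hc.preimage_mem_nhds (ho.mem_nhds h)] with t ht
      exact hinv t s ht
    have h1 : p1 ψ u s = _ := (hfw.congr_of_eventuallyEq hev).deriv
    have hP := hPDE u s h
    rw [← hψ1 u s h, h1] at hP
    have e : u ^ (l - 1) = u ^ (l - 1 - 1) * u := by
      rw [← rpow_add_one hu.ne']; simp
    refine mul_left_cancel₀ (mul_sub_sq_pos hl hs).ne' ?_
    rw [hP]
    generalize deriv f _ = D
    rw [e]
    ring
  refine ⟨f, fun u => p2 φ u 0, hf, ?_, ?_⟩
  · refine hφ2.comp (f := fun x : ℝ => (x, (0 : ℝ))) (contDiffOn_id.prodMk contDiffOn_const) ?_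
    intro x hx
    exact (hmem _ _).2 ⟨hx.1, hx.2, by simpa using hx.1⟩
  intro u s h
  obtain ⟨hu, hub, hs⟩ := (hmem u s).1 h
  have hseg : ∀ z ∈ uIcc 0 s, (u, z) ∈ Ω := by
    intro z hz
    refine (hmem u z).2 ⟨hu, hub, lt_of_le_of_lt ?_ hs⟩
    have := abs_sub_left_of_mem_uIcc hz
    rw [sub_zero, sub_zero] at this
    exact sq_le_sq.2 this
  have hint : ∫ z in (0 : ℝ)..s, 2 * u ^ (l - 1) * deriv f (u ^ l - u ^ (l - 1) * z ^ 2)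
      = p2 φ u s - p2 φ u 0 := by
    refine integral_eq_sub_of_hasDerivAt (f := fun z => p2 φ u z) (fun z hz => ?_) ?_
    · have := hasDerivAt_curve_of_contDiffOn ho hφ2 (hseg z hz) (hasDerivAt_const z u)
        (hasDerivAt_id z)
      rw [← hφ22 u z (hseg z hz)]
      simp only [id, mul_one, mul_zero, zero_add] at this
      exact this
    · refine (ContinuousOn.mul continuousOn_const (hf'.comp (by fun_prop) ?_)).intervalIntegrable
      intro z hz
      obtain ⟨-, -, h3⟩ := (hmem u z).1 (hseg z hz)
      exact rpow_sub_rpow_mul_sq_mem_Ioo hl hu hub h3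
  rw [intervalIntegral.integral_const_mul] at hint
  have hi : φ u s - s * p2 φ u s = f (u ^ l - u ^ (l - 1) * s ^ 2) := hinv u s h
  linear_combination hi - s * hint
end

section
/- Let λ ∈ ℝ, let f, g : ℝ → ℝ be smooth, and define φ : (0,∞) × ℝ → ℝ by φ(u,s) = f(u^λ − u^{λ−1}s²) + 2u^{λ−1}·s·∫₀ˢ f'(u^λ − u^{λ−1}z²) dz + g(u)·s. Then for all (u,s) ∈ (0,∞) × ℝ, setting t = u^{λ−1}(u − s²), one has φ(u,s) − s·φ₂(u,s) = f(t) and φ(u,s) − s·φ₂(u,s) + (u − s²)·φ₂₂(u,s) = f(t) + 2t·f'(t). -/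
open Real Set MeasureTheory intervalIntegral

/-- The `s`-derivative of `f (a - c s²) + 2 c s ∫₀ˢ f' (a - c z²) dz + k s`: the contributions
of the first summand and of the upper limit of integration cancel. -/
theorem hasDerivAt_comp_sub_mul_sq_add_integral {f : ℝ → ℝ} (hf : Differentiable ℝ f)
    (hf' : Continuous (deriv f)) (a c k s : ℝ) :
    HasDerivAt
      (fun t => f (a - c * t ^ 2)
        + 2 * c * t * (∫ z in (0:ℝ)..t, deriv f (a - c * z ^ 2)) + k * t)
      (2 * c * (∫ z in (0:ℝ)..s, deriv f (a - c * z ^ 2)) + k) s := by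
  have hcont : Continuous fun z : ℝ => deriv f (a - c * z ^ 2) := by fun_prop
  have hin : HasDerivAt (fun t : ℝ => a - c * t ^ 2) (-(c * (2 * s))) s := by
    simpa using ((hasDerivAt_pow 2 s).const_mul c).const_sub a
  have hcomp := (hf (a - c * s ^ 2)).hasDerivAt.comp s hin
  have hmul :=
    ((hasDerivAt_id s).const_mul (2 * c)).mul (hcont.integral_hasStrictDerivAt 0 s).hasDerivAt
  refine ((hcomp.add hmul).add ((hasDerivAt_id s).const_mul k)).congr_deriv ?_
  simp only [id]
  ring

theorem stmt6
    (l : ℝ) (f g : ℝ → ℝ) (hf : ContDiff ℝ (⊤ : ℕ∞) f) (hg : ContDiff ℝ (⊤ : ℕ∞) g)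
    (φ : ℝ → ℝ → ℝ)
    (hφ : ∀ u s, φ u s =
      f (u ^ l - u ^ (l - 1) * s ^ 2)
        + 2 * u ^ (l - 1) * s * (∫ z in (0:ℝ)..s, deriv f (u ^ l - u ^ (l - 1) * z ^ 2))
        + g u * s) :
    ∀ u : ℝ, 0 < u → ∀ s : ℝ,
      φ u s - s * p2 φ u s = f (u ^ (l - 1) * (u - s ^ 2)) ∧
        φ u s - s * p2 φ u s + (u - s ^ 2) * p22 φ u s
          = f (u ^ (l - 1) * (u - s ^ 2))
            + 2 * (u ^ (l - 1) * (u - s ^ 2)) * deriv f (u ^ (l - 1) * (u - s ^ 2)) := by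
  intro u hu s
  have hpow : u ^ l = u ^ (l - 1) * u := by
    rw [← Real.rpow_add_one hu.ne', sub_add_cancel]
  have harg : u ^ l - u ^ (l - 1) * s ^ 2 = u ^ (l - 1) * (u - s ^ 2) := by
    rw [hpow]; ring
  have hf' : Continuous (deriv f) := hf.continuous_deriv (by simp)
  have hp2 : ∀ t, p2 φ u t =
      2 * u ^ (l - 1) * (∫ z in (0:ℝ)..t, deriv f (u ^ l - u ^ (l - 1) * z ^ 2)) + g u := by
    intro t
    simp only [p2, hφ]
    exact (hasDerivAt_comp_sub_mul_sq_add_integral (hf.differentiable (by simp)) hf' _ _ _ t).deriv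
  have hp22 : p22 φ u s = 2 * u ^ (l - 1) * deriv f (u ^ l - u ^ (l - 1) * s ^ 2) := by
    have hcont : Continuous fun z : ℝ => deriv f (u ^ l - u ^ (l - 1) * z ^ 2) := by fun_prop
    simp only [p22, hp2]
    exact (((hcont.integral_hasStrictDerivAt 0 s).hasDerivAt.const_mul _).add_const _).deriv
  have hfirst : φ u s - s * p2 φ u s = f (u ^ (l - 1) * (u - s ^ 2)) := by
    rw [hφ, hp2, harg]
    ring
  refine ⟨hfirst, ?_⟩
  rw [hfirst, hp22, harg]
  ring
end

section
/- Let λ ∈ ℝ, let f, g : ℝ → ℝ be smooth with f(0) > 0 and f'(t) ≥ 0 for all t ≥ 0, and define φ : (0,∞) × ℝ → ℝ by φ(u,s) = f(u^λ − u^{λ−1}s²) + 2u^{λ−1}·s·∫₀ˢ f'(u^λ − u^{λ−1}z²) dz + g(u)·s. Then for all (u,s) with u > 0 and s² ≤ u, one has φ(u,s) − s·φ₂(u,s) > 0 and φ(u,s) − s·φ₂(u,s) + (u − s²)·φ₂₂(u,s) > 0. -/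
open Real Set MeasureTheory intervalIntegral

/-- The derivative of `f (A - a s²) + 2 a s ∫₀ˢ f' (A - a z²) dz + c s` in `s`: the two terms
containing `s f' (A - a s²)` cancel. -/
theorem hasDerivAt_add_mul_integral_deriv {f : ℝ → ℝ} (hf : ContDiff ℝ 1 f) (A a c s : ℝ) :
    HasDerivAt (fun t => f (A - a * t ^ 2)
        + 2 * a * t * (∫ z in (0:ℝ)..t, deriv f (A - a * z ^ 2)) + c * t)
      (2 * a * (∫ z in (0:ℝ)..s, deriv f (A - a * z ^ 2)) + c) s := by
  have hcont : Continuous fun z : ℝ => deriv f (A - a * z ^ 2) :=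
    (hf.continuous_deriv le_rfl).comp (by fun_prop)
  have hI : HasDerivAt (fun t => ∫ z in (0:ℝ)..t, deriv f (A - a * z ^ 2))
      (deriv f (A - a * s ^ 2)) s := hcont.integral_hasStrictDerivAt 0 s |>.hasDerivAt
  have hh : HasDerivAt (fun t : ℝ => A - a * t ^ 2) (-(a * (2 * s))) s := by
    simpa using ((hasDerivAt_pow 2 s).const_mul a).const_sub A
  have hF : HasDerivAt (fun t : ℝ => f (A - a * t ^ 2))
      (deriv f (A - a * s ^ 2) * -(a * (2 * s))) s :=
    ((hf.differentiable one_ne_zero) _).hasDerivAt.comp s hh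
  have hlin : ∀ k : ℝ, HasDerivAt (fun t : ℝ => k * t) k s := fun k => by
    simpa using (hasDerivAt_id s).const_mul k
  exact ((hF.add ((hlin (2 * a)).mul hI)).add (hlin c)).congr_deriv (by ring)

theorem stmt7
    (l : ℝ) (f g : ℝ → ℝ) (hf : ContDiff ℝ (⊤ : ℕ∞) f) (hg : ContDiff ℝ (⊤ : ℕ∞) g)
    (hf0 : 0 < f 0) (hf' : ∀ t : ℝ, 0 ≤ t → 0 ≤ deriv f t)
    (φ : ℝ → ℝ → ℝ)
    (hφ : ∀ u s, φ u s =
      f (u ^ l - u ^ (l - 1) * s ^ 2)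
        + 2 * u ^ (l - 1) * s * (∫ z in (0:ℝ)..s, deriv f (u ^ l - u ^ (l - 1) * z ^ 2))
        + g u * s) :
    ∀ u s : ℝ, 0 < u → s ^ 2 ≤ u →
      0 < φ u s - s * p2 φ u s ∧
        0 < φ u s - s * p2 φ u s + (u - s ^ 2) * p22 φ u s := by
  intro u s hu hs
  have hf1 : ContDiff ℝ 1 f := hf.of_le (by exact_mod_cast le_top)
  have hp2 : p2 φ u = fun t =>
      2 * u ^ (l - 1) * (∫ z in (0:ℝ)..t, deriv f (u ^ l - u ^ (l - 1) * z ^ 2)) + g u := by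
    funext t
    simp only [p2, hφ]
    exact (hasDerivAt_add_mul_integral_deriv hf1 _ _ _ t).deriv
  have hp22 : p22 φ u s = 2 * u ^ (l - 1) * deriv f (u ^ l - u ^ (l - 1) * s ^ 2) := by
    have hcont : Continuous fun z : ℝ => deriv f (u ^ l - u ^ (l - 1) * z ^ 2) :=
      (hf1.continuous_deriv le_rfl).comp (by fun_prop)
    simp only [p22, hp2]
    exact (((hcont.integral_hasStrictDerivAt 0 s).hasDerivAt.const_mul _).add_const _).deriv
  have ha : 0 < u ^ (l - 1) := rpow_pos_of_pos hu _
  have harg : 0 ≤ u ^ l - u ^ (l - 1) * s ^ 2 := by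
    have hul : u ^ l = u ^ (l - 1) * u := by
      rw [rpow_sub_one hu.ne', div_mul_cancel₀ _ hu.ne']
    rw [hul, ← mul_sub]
    exact mul_nonneg ha.le (sub_nonneg.2 hs)
  have hmono : MonotoneOn f (Ici 0) :=
    monotoneOn_of_deriv_nonneg (convex_Ici 0) hf1.continuous.continuousOn
      (hf1.differentiable one_ne_zero).differentiableOn
      fun t ht => hf' t (interior_subset ht)
  have hpos : 0 < f (u ^ l - u ^ (l - 1) * s ^ 2) :=
    hf0.trans_le (hmono self_mem_Ici harg harg)
  have hφs : φ u s - s * p2 φ u s = f (u ^ l - u ^ (l - 1) * s ^ 2) := by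
    rw [hp2, hφ]
    ring
  rw [hφs, hp22]
  exact ⟨hpos, add_pos_of_pos_of_nonneg hpos
    (mul_nonneg (sub_nonneg.2 hs) (mul_nonneg (by positivity) (hf' _ harg)))⟩
end

section
/- Let λ > 0 and let g : ℝ → ℝ be smooth. Define φ on {(u,s) : 0 < u < 1, s ∈ ℝ} by φ(u,s) = √(1 − u^λ + u^{λ−1}s²)/(1 − u^λ) + g(u)·s (the argument of the square root is positive since 0 < u < 1 and λ > 0). Then φ is smooth and satisfies (λu − (λ−1)s²)·φ₂₂(u,s) = 2u·(φ₁(u,s) − s·φ₁₂(u,s)) for all 0 < u < 1 and s ∈ ℝ. -/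
open Real Set MeasureTheory intervalIntegral

/-- The quantity under the square root of the Randers metric. -/
noncomputable def radicand (l u s : ℝ) : ℝ := 1 - u ^ l + u ^ (l - 1) * s ^ 2

lemma one_sub_rpow_pos {l u : ℝ} (hl : 0 < l) (hu : 0 < u) (hu' : u < 1) : 0 < 1 - u ^ l :=
  sub_pos.2 (Real.rpow_lt_one hu.le hu' hl)

lemma radicand_pos {l u : ℝ} (hl : 0 < l) (hu : 0 < u) (hu' : u < 1) (s : ℝ) :
    0 < radicand l u s := by
  have := one_sub_rpow_pos hl hu hu'
  unfold radicand
  positivity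

lemma hasDerivAt_radicand_right (l u s : ℝ) :
    HasDerivAt (fun t => radicand l u t) (u ^ (l - 1) * (2 * s)) s := by
  simpa [radicand] using ((hasDerivAt_pow 2 s).const_mul (u ^ (l - 1))).const_add (1 - u ^ l)

lemma hasDerivAt_radicand_left (l : ℝ) {u : ℝ} (hu : 0 < u) (s : ℝ) :
    HasDerivAt (fun t => radicand l t s)
      (-(l * u ^ (l - 1)) + (l - 1) * u ^ (l - 1 - 1) * s ^ 2) u :=
  ((Real.hasDerivAt_rpow_const (Or.inl hu.ne')).const_sub 1).add
    ((Real.hasDerivAt_rpow_const (Or.inl hu.ne')).mul_const (s ^ 2))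

/-- The irrational part of the Randers metric is smooth on the strip `0 < u < 1`. -/
lemma contDiffOn_sqrt_radicand_div {l : ℝ} (hl : 0 < l) :
    ContDiffOn ℝ (⊤ : ℕ∞) (fun q : ℝ × ℝ => √(radicand l q.1 q.2) / (1 - q.1 ^ l))
      (Ioo (0 : ℝ) 1 ×ˢ univ) := by
  have hpow (r : ℝ) : ContDiffOn ℝ (⊤ : ℕ∞) (fun q : ℝ × ℝ => q.1 ^ r)
      (Ioo (0 : ℝ) 1 ×ˢ univ) :=
    contDiffOn_fst.rpow_const_of_ne fun q hq => hq.1.1.ne'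
  have hD := (contDiffOn_const (c := (1 : ℝ))).sub (hpow l)
  refine ContDiffOn.div (ContDiffOn.sqrt ?_ fun q hq => ?_) hD fun q hq => ?_
  · exact hD.add ((hpow (l - 1)).mul (contDiffOn_snd.pow 2))
  · exact (radicand_pos hl hq.1.1 hq.1.2 q.2).ne'
  · exact (one_sub_rpow_pos hl hq.1.1 hq.1.2).ne'

lemma hasDerivAt_sqrt_radicand_right {l u : ℝ} (hl : 0 < l) (hu : 0 < u) (hu' : u < 1) (s : ℝ) :
    HasDerivAt (fun t => √(radicand l u t)) (u ^ (l - 1) * s / √(radicand l u s)) s := by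
  convert (hasDerivAt_radicand_right l u s).sqrt (radicand_pos hl hu hu' s).ne' using 1
  have := Real.sqrt_pos.2 (radicand_pos hl hu hu' s)
  field_simp

lemma hasDerivAt_inv_sqrt_radicand {l u : ℝ} (hl : 0 < l) (hu : 0 < u) (hu' : u < 1) (s : ℝ) :
    HasDerivAt (fun t => (√(radicand l t s))⁻¹)
      ((l * u - (l - 1) * s ^ 2) * u ^ (l - 1) / (2 * u * √(radicand l u s) ^ 3)) u := by
  have hR := Real.sqrt_pos.2 (radicand_pos hl hu hu' s)
  refine (((hasDerivAt_radicand_left l hu s).sqrt (radicand_pos hl hu hu' s).ne').inv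
    hR.ne').congr_deriv ?_
  rw [Real.rpow_sub_one hu.ne' (l - 1)]
  field_simp
  ring

theorem stmt8
    (l : ℝ) (hl : 0 < l) (g : ℝ → ℝ) (hg : ContDiff ℝ (⊤ : ℕ∞) g)
    (φ : ℝ → ℝ → ℝ)
    (hφ : ∀ u s, φ u s =
      Real.sqrt (1 - u ^ l + u ^ (l - 1) * s ^ 2) / (1 - u ^ l) + g u * s) :
    ContDiffOn ℝ (⊤ : ℕ∞) (Function.uncurry φ) (Set.Ioo (0:ℝ) 1 ×ˢ (Set.univ : Set ℝ)) ∧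
      ∀ u : ℝ, 0 < u → u < 1 → ∀ s : ℝ,
        (l * u - (l - 1) * s ^ 2) * p22 φ u s
          = 2 * u * (p1 φ u s - s * p12 φ u s) := by
  have hφ' (u s : ℝ) : φ u s = √(radicand l u s) / (1 - u ^ l) + g u * s := hφ u s
  refine ⟨?_, fun u hu hu' s => ?_⟩
  · refine ((contDiffOn_sqrt_radicand_div hl).add
      ((hg.comp contDiff_fst).mul contDiff_snd).contDiffOn).congr fun q _ => ?_
    exact hφ' q.1 q.2
  have hp2 {v : ℝ} (hv : 0 < v) (hv' : v < 1) (t : ℝ) :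
      p2 φ v t = v ^ (l - 1) * t / √(radicand l v t) / (1 - v ^ l) + g v := by
    have h := ((hasDerivAt_sqrt_radicand_right hl hv hv' t).div_const (1 - v ^ l)).add
      ((hasDerivAt_id t).const_mul (g v))
    rw [mul_one] at h
    rw [p2, funext (hφ' v)]
    exact h.deriv
  have hD := one_sub_rpow_pos hl hu hu'
  have hR := Real.sqrt_pos.2 (radicand_pos hl hu hu' s)
  have hsq {v : ℝ} (hv : 0 < v) (hv' : v < 1) :
      √(radicand l v s) ^ 2 = 1 - v ^ l + v ^ (l - 1) * s ^ 2 :=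
    Real.sq_sqrt (radicand_pos hl hv hv' s).le
  have hp22 : p22 φ u s = u ^ (l - 1) / √(radicand l u s) ^ 3 := by
    have h := (((((hasDerivAt_id s).const_mul (u ^ (l - 1))).div
      (hasDerivAt_sqrt_radicand_right hl hu hu' s) hR.ne').div_const (1 - u ^ l)).add_const (g u))
    rw [p22, funext (hp2 hu hu')]
    refine h.deriv.trans ?_
    have hs := hsq hu hu'
    simp only [id]
    field_simp
    linear_combination hs
  have hsqrt : DifferentiableAt ℝ (fun t => √(radicand l t s)) u :=
    (hasDerivAt_radicand_left l hu s).differentiableAt.sqrt (radicand_pos hl hu hu' s).ne'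
  have hpow (r : ℝ) : DifferentiableAt ℝ (fun t : ℝ => t ^ r) u :=
    (Real.hasDerivAt_rpow_const (Or.inl hu.ne')).differentiableAt
  have hDd : DifferentiableAt ℝ (fun t : ℝ => 1 - t ^ l) u := (hpow l).const_sub 1
  have hgd : DifferentiableAt ℝ g u := hg.differentiable (by simp) u
  have hnear : ∀ᶠ v in nhds u, v ∈ Ioo (0 : ℝ) 1 := Ioo_mem_nhds hu hu'
  have hd1 : DifferentiableAt ℝ (fun t => φ t s) u := by
    rw [funext fun t => hφ' t s]
    exact (hsqrt.div hDd hD.ne').add (hgd.mul_const s)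
  have hd2 : DifferentiableAt ℝ (fun t => p2 φ t s) u := by
    refine DifferentiableAt.congr_of_eventuallyEq
      (((((hpow (l - 1)).mul_const s).div hsqrt hR.ne').div hDd hD.ne').add hgd) ?_
    filter_upwards [hnear] with v hv using hp2 hv.1 hv.2 s
  have hinv : (fun t => φ t s - s * p2 φ t s) =ᶠ[nhds u] fun t => (√(radicand l t s))⁻¹ := by
    filter_upwards [hnear] with v hv
    have hDv := one_sub_rpow_pos hl hv.1 hv.2
    have hRv := Real.sqrt_pos.2 (radicand_pos hl hv.1 hv.2 s)
    have hs := hsq hv.1 hv.2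
    rw [hφ', hp2 hv.1 hv.2]
    field_simp
    linear_combination hs
  have hp1 : p1 φ u s - s * p12 φ u s =
      (l * u - (l - 1) * s ^ 2) * u ^ (l - 1) / (2 * u * √(radicand l u s) ^ 3) :=
    ((hd1.hasDerivAt.sub (hd2.hasDerivAt.const_mul s)).congr_of_eventuallyEq hinv.symm).unique
      (hasDerivAt_inv_sqrt_radicand hl hu hu' s)
  rw [hp22, hp1]
  field_simp
end

section
/- Let λ ∈ ℝ and let g : ℝ → ℝ be smooth. Define φ : (0,∞) × ℝ → ℝ by φ(u,s) = u^{λ−1}·s² + g(u)·s + 1 + u^λ. Then φ is smooth and satisfies (λu − (λ−1)s²)·φ₂₂(u,s) = 2u·(φ₁(u,s) − s·φ₁₂(u,s)) for all (u,s) ∈ (0,∞) × ℝ. -/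
open Real Set MeasureTheory intervalIntegral

theorem stmt9
    (l : ℝ) (g : ℝ → ℝ) (hg : ContDiff ℝ (⊤ : ℕ∞) g)
    (φ : ℝ → ℝ → ℝ)
    (hφ : ∀ u s, φ u s = u ^ (l - 1) * s ^ 2 + g u * s + 1 + u ^ l) :
    ContDiffOn ℝ (⊤ : ℕ∞) (Function.uncurry φ) (Set.Ioi (0:ℝ) ×ˢ (Set.univ : Set ℝ)) ∧
      ∀ u : ℝ, 0 < u → ∀ s : ℝ,
        (l * u - (l - 1) * s ^ 2) * p22 φ u s
          = 2 * u * (p1 φ u s - s * p12 φ u s) := by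
  obtain rfl : φ = fun u s => u ^ (l - 1) * s ^ 2 + g u * s + 1 + u ^ l := by
    funext u s
    exact hφ u s
  have h2 : p2 (fun u s => u ^ (l - 1) * s ^ 2 + g u * s + 1 + u ^ l)
      = fun u s => u ^ (l - 1) * (2 * s) + g u := by
    funext u s
    have h := (((((hasDerivAt_id s).pow 2).const_mul (u ^ (l - 1))).add
      ((hasDerivAt_id s).const_mul (g u))).add_const 1).add_const (u ^ l)
    refine (h.congr_deriv ?_).deriv
    simp
  refine ⟨?_, fun u hu s => ?_⟩
  · have hpow (r : ℝ) : ContDiffOn ℝ (⊤ : ℕ∞) (fun p : ℝ × ℝ => p.1 ^ r)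
        (Ioi (0 : ℝ) ×ˢ (univ : Set ℝ)) :=
      contDiff_fst.contDiffOn.rpow_const_of_ne fun p hp => hp.1.ne'
    exact ((((hpow (l - 1)).mul (contDiff_snd.pow 2).contDiffOn).add
      ((hg.comp contDiff_fst).mul contDiff_snd).contDiffOn).add contDiffOn_const).add (hpow l)
  · have hgu : HasDerivAt g (deriv g u) u :=
      (hg.differentiable (by simp)).differentiableAt.hasDerivAt
    have hpow (r : ℝ) : HasDerivAt (fun t : ℝ => t ^ r) (r * u ^ (r - 1)) u :=
      hasDerivAt_rpow_const (Or.inl hu.ne')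
    have h1 : p1 (fun u s => u ^ (l - 1) * s ^ 2 + g u * s + 1 + u ^ l) u s
        = (l - 1) * u ^ (l - 1 - 1) * s ^ 2 + deriv g u * s + l * u ^ (l - 1) :=
      (((((hpow (l - 1)).mul_const (s ^ 2)).add (hgu.mul_const s)).add_const 1).add
        (hpow l)).deriv
    have h12 : p12 (fun u s => u ^ (l - 1) * s ^ 2 + g u * s + 1 + u ^ l) u s
        = (l - 1) * u ^ (l - 1 - 1) * (2 * s) + deriv g u := by
      rw [p12, h2]
      exact (((hpow (l - 1)).mul_const (2 * s)).add hgu).deriv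
    have h22 : p22 (fun u s => u ^ (l - 1) * s ^ 2 + g u * s + 1 + u ^ l) u s
        = u ^ (l - 1) * 2 := by
      rw [p22, h2]
      have h := (((hasDerivAt_id s).const_mul 2).const_mul (u ^ (l - 1))).add_const (g u)
      exact (h.congr_deriv (by simp)).deriv
    have hu1 : u ^ (l - 1) = u ^ (l - 1 - 1) * u := by
      rw [rpow_sub_one hu.ne' (l - 1), div_mul_cancel₀ _ hu.ne']
    rw [h1, h12, h22, hu1]
    ring
end

section
/- Let λ ∈ ℝ and let g : ℝ → ℝ be smooth. Define φ : (0,∞) × ℝ → ℝ by φ(u,s) = −(u^{2(λ−1)}/3)·s⁴ + 2u^{2λ−1}·s² + g(u)·s + 1 + u^{2λ}. Then φ is smooth and satisfies (λu − (λ−1)s²)·φ₂₂(u,s) = 2u·(φ₁(u,s) − s·φ₁₂(u,s)) for all (u,s) ∈ (0,∞) × ℝ. -/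
open Real Set MeasureTheory intervalIntegral

theorem stmt10
    (l : ℝ) (g : ℝ → ℝ) (hg : ContDiff ℝ (⊤ : ℕ∞) g)
    (φ : ℝ → ℝ → ℝ)
    (hφ : ∀ u s, φ u s =
      -(u ^ (2 * (l - 1)) / 3) * s ^ 4 + 2 * u ^ (2 * l - 1) * s ^ 2
        + g u * s + 1 + u ^ (2 * l)) :
    ContDiffOn ℝ (⊤ : ℕ∞) (Function.uncurry φ) (Set.Ioi (0:ℝ) ×ˢ (Set.univ : Set ℝ)) ∧
      ∀ u : ℝ, 0 < u → ∀ s : ℝ,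
        (l * u - (l - 1) * s ^ 2) * p22 φ u s
          = 2 * u * (p1 φ u s - s * p12 φ u s) := by
  refine ⟨?_, fun u hu s => ?_⟩
  · have huncurry : Function.uncurry φ = fun p : ℝ × ℝ =>
        -(p.1 ^ (2 * (l - 1)) / 3) * p.2 ^ 4 + 2 * p.1 ^ (2 * l - 1) * p.2 ^ 2
          + g p.1 * p.2 + 1 + p.1 ^ (2 * l) := by
      ext ⟨u, s⟩
      exact hφ u s
    have hpow (r : ℝ) : ContDiffOn ℝ (⊤ : ℕ∞) (fun p : ℝ × ℝ => p.1 ^ r)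
        (Set.Ioi (0:ℝ) ×ˢ (Set.univ : Set ℝ)) :=
      contDiffOn_fst.rpow_const_of_ne fun p hp => ne_of_gt hp.1
    have hg' : ContDiffOn ℝ (⊤ : ℕ∞) (fun p : ℝ × ℝ => g p.1)
        (Set.Ioi (0:ℝ) ×ˢ (Set.univ : Set ℝ)) := (hg.comp contDiff_fst).contDiffOn
    have hs : ContDiffOn ℝ (⊤ : ℕ∞) (fun p : ℝ × ℝ => p.2)
        (Set.Ioi (0:ℝ) ×ˢ (Set.univ : Set ℝ)) := contDiffOn_snd
    rw [huncurry]
    exact (((((((hpow _).div_const 3).neg).mul (hs.pow 4)).add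
      ((contDiffOn_const.mul (hpow _)).mul (hs.pow 2))).add (hg'.mul hs)).add
      contDiffOn_const).add (hpow _)
  · have hpow (r : ℝ) : HasDerivAt (fun t : ℝ => t ^ r) (r * u ^ (r - 1)) u :=
      hasDerivAt_rpow_const (Or.inl hu.ne')
    have hgu : HasDerivAt g (deriv g u) u :=
      (hg.differentiable (by simp)).differentiableAt.hasDerivAt
    have h₂ (t x : ℝ) : p2 φ t x = -(t ^ (2 * (l - 1)) / 3) * (4 * x ^ 3)
        + 2 * t ^ (2 * l - 1) * (2 * x) + g t := by
      have h := (((((hasDerivAt_pow 4 x).const_mul (-(t ^ (2 * (l - 1)) / 3))).add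
        ((hasDerivAt_pow 2 x).const_mul (2 * t ^ (2 * l - 1)))).add
        ((hasDerivAt_id x).const_mul (g t))).add_const 1).add_const (t ^ (2 * l))
      simp only [p2, hφ]
      refine (h.congr_deriv ?_).deriv
      norm_num
    have h₂₂ : p22 φ u s = -(u ^ (2 * (l - 1)) / 3) * (12 * s ^ 2)
        + 4 * u ^ (2 * l - 1) := by
      have h := ((((hasDerivAt_pow 3 s).const_mul 4).const_mul
        (-(u ^ (2 * (l - 1)) / 3))).add
        (((hasDerivAt_id s).const_mul 2).const_mul (2 * u ^ (2 * l - 1)))).add_const (g u)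
      simp only [p22, h₂]
      refine (h.congr_deriv ?_).deriv
      norm_num
      ring
    have h₁ : p1 φ u s = -(2 * (l - 1) * u ^ (2 * (l - 1) - 1) / 3) * s ^ 4
        + 2 * ((2 * l - 1) * u ^ (2 * l - 1 - 1)) * s ^ 2 + deriv g u * s
        + 2 * l * u ^ (2 * l - 1) := by
      have h := ((((((hpow (2 * (l - 1))).div_const 3).neg.mul_const (s ^ 4)).add
        (((hpow (2 * l - 1)).const_mul 2).mul_const (s ^ 2))).add
        (hgu.mul_const s)).add_const 1).add (hpow (2 * l))
      simp only [p1, hφ]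
      exact h.deriv
    have h₁₂ : p12 φ u s = -(2 * (l - 1) * u ^ (2 * (l - 1) - 1) / 3) * (4 * s ^ 3)
        + 2 * ((2 * l - 1) * u ^ (2 * l - 1 - 1)) * (2 * s) + deriv g u := by
      have h := ((((hpow (2 * (l - 1))).div_const 3).neg.mul_const (4 * s ^ 3)).add
        (((hpow (2 * l - 1)).const_mul 2).mul_const (2 * s))).add hgu
      simp only [p12, h₂]
      exact h.deriv
    have e₁ : u ^ (2 * l - 1) = u ^ (2 * (l - 1) - 1) * u ^ 2 := by
      rw [← rpow_add_natCast hu.ne']; congr 1; push_cast; ring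
    have e₂ : u ^ (2 * (l - 1)) = u ^ (2 * (l - 1) - 1) * u := by
      rw [← rpow_add_one hu.ne']; congr 1; ring
    have e₃ : u ^ (2 * l - 1 - 1) = u ^ (2 * (l - 1) - 1) * u := by
      rw [← rpow_add_one hu.ne']; congr 1; ring
    rw [h₂₂, h₁, h₁₂, e₃, e₂, e₁]
    ring
end

section
/- Let b₀ > 0 and let f, g : ℝ → ℝ be smooth. Define φ on Ω = {(u,s) ∈ ℝ² : 0 < u < b₀, s ∈ ℝ} by φ(u,s) = f(u − s²) + 2s·∫₀ˢ f'(u − z²) dz + g(u)·s. Then φ is smooth, satisfies φ₂₂(u,s) = 2·(φ₁(u,s) − s·φ₁₂(u,s)) on Ω, and moreover φ(u,s) − s·φ₂(u,s) = f(u − s²) and φ(u,s) − s·φ₂(u,s) + (u − s²)·φ₂₂(u,s) = f(u − s²) + 2(u − s²)·f'(u − s²) for all (u,s) ∈ Ω. -/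
open Real Set MeasureTheory intervalIntegral

open scoped ContDiff

/-- Differentiation under the integral sign for a parameter on which the integrand depends in a
continuously differentiable way. -/
theorem hasDerivAt_intervalIntegral_of_continuous_deriv {F F' : ℝ → ℝ → ℝ}
    (hF : Continuous (Function.uncurry F)) (hF' : Continuous (Function.uncurry F'))
    (hd : ∀ u z, HasDerivAt (fun t => F t z) (F' u z) u) (a b u : ℝ) :
    HasDerivAt (fun t => ∫ z in a..b, F t z) (∫ z in a..b, F' u z) u := by
  obtain ⟨C, hC⟩ := ((isCompact_closedBall u 1).prod (isCompact_uIcc (a := a) (b := b)))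
    |>.exists_bound_of_continuousOn hF'.continuousOn
  refine (intervalIntegral.hasDerivAt_integral_of_dominated_loc_of_deriv_le
    (Metric.closedBall_mem_nhds u one_pos) (bound := fun _ => C) ?_ ?_ ?_ ?_ ?_ ?_).2
  · exact .of_forall fun t => (hF.uncurry_left t).aestronglyMeasurable
  · exact (hF.uncurry_left u).intervalIntegrable a b
  · exact (hF'.uncurry_left u).aestronglyMeasurable
  · exact .of_forall fun z hz t ht => hC (t, z) ⟨ht, uIoc_subset_uIcc hz⟩
  · exact intervalIntegrable_const
  · exact .of_forall fun z _ t _ => hd t z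

/-- The primitive of a `C^n` function of two variables in its second variable is jointly `C^n`. -/
theorem contDiff_parametric_primitive_nat (a : ℝ) (n : ℕ) : ∀ {F : ℝ → ℝ → ℝ},
    ContDiff ℝ n (Function.uncurry F) →
      ContDiff ℝ n (fun p : ℝ × ℝ => ∫ z in a..p.2, F p.1 z) := by
  induction n with
  | zero =>
    intro F hF
    have hc : Continuous (Function.uncurry F) := hF.continuous
    exact contDiff_zero.2 (continuous_parametric_intervalIntegral_of_continuous
      (f := fun p : ℝ × ℝ => F p.1) (hc.comp (by fun_prop : Continuous
        fun q : (ℝ × ℝ) × ℝ => (q.1.1, q.2))) continuous_snd)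
  | succ n ih =>
    intro F hF
    have hF0 : ContDiff ℝ n (Function.uncurry F) := hF.of_le (by exact_mod_cast n.le_succ)
    have hc : Continuous (Function.uncurry F) := hF.continuous
    let F' : ℝ → ℝ → ℝ := fun u z => fderiv ℝ (Function.uncurry F) (u, z) (1, 0)
    have hF' : ContDiff ℝ n (Function.uncurry F') :=
      (hF.fderiv_right (m := n) (by norm_cast)).clm_apply contDiff_const
    have hd : ∀ u z, HasDerivAt (fun t => F t z) (F' u z) u := fun u z =>
      HasFDerivAt.comp_hasDerivAt (f := fun t => (t, z)) u
        (hF.differentiable (by simp) (u, z)).hasFDerivAt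
        ((hasDerivAt_id u).prodMk (hasDerivAt_const u z))
    have h₁ := ih hF'
    push_cast
    refine contDiff_succ_iff_hasFDerivAt.2
      ⟨fun p => (ContinuousLinearMap.toSpanSingleton ℝ (∫ z in a..p.2, F' p.1 z)).coprod
        (ContinuousLinearMap.toSpanSingleton ℝ (F p.1 p.2)), ?_, fun p => ?_⟩
    · have h : ∀ x y : ℝ, (ContinuousLinearMap.toSpanSingleton ℝ x).coprod
          (ContinuousLinearMap.toSpanSingleton ℝ y) =
          x • ContinuousLinearMap.fst ℝ ℝ ℝ + y • ContinuousLinearMap.snd ℝ ℝ ℝ := by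
        intro x y
        ext <;> simp
      simp only [h]
      exact (h₁.smul contDiff_const).add (hF0.smul contDiff_const)
    · have hs : Continuous fun x : ℝ => ContinuousLinearMap.toSpanSingleton ℝ x :=
        (ContinuousLinearMap.toSpanSingletonCLE (𝕜 := ℝ) (E := ℝ)).continuous
      exact (hasStrictFDerivAt_uncurry_coprod (𝕜 := ℝ) (u := p)
        (f := fun u s => ∫ z in a..s, F u z)
        (f₁ := fun u s => ContinuousLinearMap.toSpanSingleton ℝ (∫ z in a..s, F' u z))
        (f₂ := fun u s => ContinuousLinearMap.toSpanSingleton ℝ (F u s))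
        (.of_forall fun v => (hasDerivAt_intervalIntegral_of_continuous_deriv hc
          hF'.continuous hd a v.2 v.1).hasFDerivAt)
        (.of_forall fun v => ((hc.uncurry_left v.1).integral_hasStrictDerivAt
          a v.2).hasDerivAt.hasFDerivAt)
        (hs.comp h₁.continuous).continuousAt (hs.comp hc).continuousAt).hasFDerivAt

/-- The primitive of a smooth function of two variables in its second variable is jointly smooth. -/
theorem contDiff_parametric_primitive (a : ℝ) {F : ℝ → ℝ → ℝ}
    (hF : ContDiff ℝ ∞ (Function.uncurry F)) :
    ContDiff ℝ ∞ (fun p : ℝ × ℝ => ∫ z in a..p.2, F p.1 z) :=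
  contDiff_infty.2 fun n => contDiff_parametric_primitive_nat a n (contDiff_infty.1 hF n)

theorem stmt12
    (b₀ : ℝ) (hb₀ : 0 < b₀)
    (f g : ℝ → ℝ) (hf : ContDiff ℝ (⊤ : ℕ∞) f) (hg : ContDiff ℝ (⊤ : ℕ∞) g)
    (Ω : Set (ℝ × ℝ))
    (hΩ : Ω = {p : ℝ × ℝ | 0 < p.1 ∧ p.1 < b₀})
    (φ : ℝ → ℝ → ℝ)
    (hφ : ∀ u s : ℝ, (u, s) ∈ Ω → φ u s =
      f (u - s ^ 2) + 2 * s * (∫ z in (0:ℝ)..s, deriv f (u - z ^ 2)) + g u * s) :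
    ContDiffOn ℝ (⊤ : ℕ∞) (Function.uncurry φ) Ω ∧
      (∀ u s : ℝ, (u, s) ∈ Ω →
        p22 φ u s = 2 * (p1 φ u s - s * p12 φ u s)) ∧
      (∀ u s : ℝ, (u, s) ∈ Ω →
        φ u s - s * p2 φ u s = f (u - s ^ 2) ∧
          φ u s - s * p2 φ u s + (u - s ^ 2) * p22 φ u s
            = f (u - s ^ 2) + 2 * (u - s ^ 2) * deriv f (u - s ^ 2)) := by
  have hf' : ContDiff ℝ ∞ (deriv f) := (contDiff_infty_iff_deriv.1 hf).2
  have hf'' : ContDiff ℝ ∞ (deriv (deriv f)) := (contDiff_infty_iff_deriv.1 hf').2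
  have df : ∀ x, HasDerivAt f (deriv f x) x := fun x =>
    (hf.differentiable (by simp) x).hasDerivAt
  have df' : ∀ x, HasDerivAt (deriv f) (deriv (deriv f) x) x := fun x =>
    (hf'.differentiable (by simp) x).hasDerivAt
  have dg : ∀ x, HasDerivAt g (deriv g x) x := fun x =>
    (hg.differentiable (by simp) x).hasDerivAt
  have hsub : ContDiff ℝ ∞ (fun p : ℝ × ℝ => p.1 - p.2 ^ 2) := by fun_prop
  have hF : ContDiff ℝ ∞ (Function.uncurry fun u z : ℝ => deriv f (u - z ^ 2)) := hf'.comp hsub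
  have hF' : ContDiff ℝ ∞ (Function.uncurry fun u z : ℝ => deriv (deriv f) (u - z ^ 2)) :=
    hf''.comp hsub
  have dIs : ∀ u s : ℝ, HasDerivAt (fun t => ∫ z in (0:ℝ)..t, deriv f (u - z ^ 2))
      (deriv f (u - s ^ 2)) s := fun u s =>
    ((hF.continuous.uncurry_left u).integral_hasStrictDerivAt 0 s).hasDerivAt
  have dIu : ∀ u s : ℝ, HasDerivAt (fun t => ∫ z in (0:ℝ)..s, deriv f (t - z ^ 2))
      (∫ z in (0:ℝ)..s, deriv (deriv f) (u - z ^ 2)) u := fun u s =>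
    hasDerivAt_intervalIntegral_of_continuous_deriv hF.continuous hF'.continuous
      (fun u z => (df' (u - z ^ 2)).comp_sub_const u (z ^ 2)) 0 s u
  have hmem : ∀ {u s : ℝ}, (u, s) ∈ Ω → ∀ t, (u, t) ∈ Ω := by
    subst hΩ
    exact fun h _ => h
  have hnhds : ∀ {u s : ℝ}, (u, s) ∈ Ω → ∀ᶠ t in nhds u, (t, s) ∈ Ω := by
    subst hΩ
    exact fun h => Ioo_mem_nhds h.1 h.2
  have e2 : ∀ u s : ℝ, (u, s) ∈ Ω →
      p2 φ u s = 2 * (∫ z in (0:ℝ)..s, deriv f (u - z ^ 2)) + g u := by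
    intro u s h
    have hφu : (fun t => φ u t) = fun t =>
        f (u - t ^ 2) + 2 * t * (∫ z in (0:ℝ)..t, deriv f (u - z ^ 2)) + g u * t :=
      funext fun t => hφ u t (hmem h t)
    have hsq : HasDerivAt (fun t : ℝ => u - t ^ 2) (-(2 * s)) s := by
      simpa using (hasDerivAt_pow 2 s).const_sub u
    rw [p2, hφu]
    refine ((((df (u - s ^ 2)).comp s hsq).add
      (((hasDerivAt_id s).const_mul 2).mul (dIs u s))).add
      ((hasDerivAt_id s).const_mul (g u))).deriv.trans ?_
    simp only [id]
    ring
  have e22 : ∀ u s : ℝ, (u, s) ∈ Ω → p22 φ u s = 2 * deriv f (u - s ^ 2) := by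
    intro u s h
    rw [p22, funext fun t => e2 u t (hmem h t)]
    exact (((dIs u s).const_mul 2).add_const (g u)).deriv
  have e1 : ∀ u s : ℝ, (u, s) ∈ Ω → p1 φ u s = deriv f (u - s ^ 2) +
      2 * s * (∫ z in (0:ℝ)..s, deriv (deriv f) (u - z ^ 2)) + deriv g u * s := by
    intro u s h
    rw [p1, Filter.EventuallyEq.deriv_eq ((hnhds h).mono fun t ht => hφ t s ht)]
    exact ((((df (u - s ^ 2)).comp_sub_const u (s ^ 2)).add
      ((dIu u s).const_mul (2 * s))).add ((dg u).mul_const s)).deriv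
  have e12 : ∀ u s : ℝ, (u, s) ∈ Ω → p12 φ u s =
      2 * (∫ z in (0:ℝ)..s, deriv (deriv f) (u - z ^ 2)) + deriv g u := by
    intro u s h
    rw [p12, Filter.EventuallyEq.deriv_eq ((hnhds h).mono fun t ht => e2 t s ht)]
    exact (((dIu u s).const_mul 2).add (dg u)).deriv
  refine ⟨?_, fun u s h => ?_, fun u s h => ⟨?_, ?_⟩⟩
  · have hI := contDiff_parametric_primitive 0 hF
    refine ContDiff.contDiffOn (((hf.comp hsub).add
      ((contDiff_const (c := (2 : ℝ))).mul contDiff_snd |>.mul hI)).add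
      ((hg.comp contDiff_fst).mul contDiff_snd)) |>.congr fun p hp => hφ p.1 p.2 hp
  · rw [e22 u s h, e1 u s h, e12 u s h]
    ring
  · rw [e2 u s h, hφ u s h]
    ring
  · rw [e2 u s h, hφ u s h, e22 u s h]
    ring
end
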